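/- arXiv:1703.06111 — 5 statements merged into one kernel-verified Lean document; each statement's English description precedes it below -/
import Mathlib

section
/- For every integer n ≥ 4, the (n,2)-star graph S_{n,2} is a Cayley graph if and only if n is a prime power. -/
open Equiv

/-- Vertices of the `(n,k)`-star graph: `k`-permutations of an `n`-set, i.e.
ordered `k`-tuples of distinct elements (positions and values are `0`-indexed,
so "position 1" of the paper is the index `j : Fin k` with `j.1 = 0`). -/
def StarVertex (n k : ℕ) : Type :=
  {a : Fin k → Fin n // Function.Injective a}

/-- `u` and `v` are joined by a residual edge: they differ exactly in position 1. -/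
def IsResEdge {n k : ℕ} (u v : StarVertex n k) : Prop :=
  (∀ j : Fin k, j.1 = 0 → u.1 j ≠ v.1 j) ∧ ∀ j : Fin k, j.1 ≠ 0 → u.1 j = v.1 j

/-- `u` and `v` are joined by a star edge: `v` is obtained from `u` by exchanging
the entries in position 1 and position `i` for some position `i ≠ 1`. -/
def IsStarEdge {n k : ℕ} (u v : StarVertex n k) : Prop :=
  ∃ i : Fin k, i.1 ≠ 0 ∧
    (∀ j : Fin k, j.1 = 0 → v.1 j = u.1 i ∧ v.1 i = u.1 j) ∧
    ∀ j : Fin k, j.1 ≠ 0 → j ≠ i → v.1 j = u.1 j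

/-- The `(n,k)`-star graph `S_{n,k}`. -/
def starGraph (n k : ℕ) : SimpleGraph (StarVertex n k) :=
  SimpleGraph.fromRel fun u v => IsStarEdge u v ∨ IsResEdge u v

/-- A (finite) graph is a Cayley graph if it is isomorphic to the Cayley graph of some
finite group `G` with connection set `S ⊆ G` satisfying `1 ∉ S` and `S = S⁻¹`. -/
def IsCayleyGraph {V : Type*} (Γ : SimpleGraph V) : Prop :=
  ∃ (G : Type) (_ : Group G) (_ : Fintype G) (S : Set G),
    (1 : G) ∉ S ∧ (∀ s ∈ S, s⁻¹ ∈ S) ∧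
    Nonempty (Γ ≃g SimpleGraph.fromRel fun g h : G => g⁻¹ * h ∈ S)

/-- The automorphism group of a graph, as a subgroup of the permutation group
of the vertex set. -/
def graphAut {V : Type*} (Γ : SimpleGraph V) : Subgroup (Equiv.Perm V) where
  carrier := {σ | ∀ u w : V, Γ.Adj (σ u) (σ w) ↔ Γ.Adj u w}
  one_mem' := by intro u w; simp
  mul_mem' := by
    intro a b ha hb u w
    rw [Equiv.Perm.mul_apply, Equiv.Perm.mul_apply, ha, hb]
  inv_mem' := by
    intro a ha u w
    simpa using (ha (a⁻¹ u) (a⁻¹ w)).symm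

/-- The copy of `S_{k-1}` inside the symmetric group on the `k` positions:
permutations of the positions `2,…,k` fixing position `1`. (Via the further
identification of positions `2,…,k` with the corresponding points, this is the
subgroup `S_{k-1} ≤ S_n` of the paper.) -/
def SkSub (k : ℕ) : Subgroup (Equiv.Perm (Fin k)) where
  carrier := {ν | ∀ j : Fin k, j.1 = 0 → ν j = j}
  one_mem' := by intro j hj; simp
  mul_mem' := by
    intro a b ha hb j hj
    rw [Equiv.Perm.mul_apply, hb j hj, ha j hj]
  inv_mem' := by
    intro a ha j hj
    have h : a⁻¹ (a j) = j := by simp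
    rwa [ha j hj] at h

/-- The vertex `ē = [1,2,…,k]` of `S_{n,k}`. -/
def eVert (n k : ℕ) (h : k ≤ n) : StarVertex n k :=
  ⟨fun j => ⟨j.1, lt_of_lt_of_le j.2 h⟩, fun a b hab => Fin.ext (by simpa using congrArg Fin.val hab)⟩

/-- The action `φ(μ,ν)` on vertices: `[a_1,…,a_k] ↦ [μ(a_{ν⁻¹(1)}),…,μ(a_{ν⁻¹(k)})]`. -/
def phi (n k : ℕ) (μ : Equiv.Perm (Fin n)) (ν : Equiv.Perm (Fin k))
    (a : StarVertex n k) : StarVertex n k :=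
  ⟨fun j => μ (a.1 (ν⁻¹ j)), fun x y hxy =>
    (Equiv.injective ν⁻¹) (a.2 (Equiv.injective μ hxy))⟩

/-- `φ(μ,ν)` as a permutation of the vertices of `S_{n,k}`. -/
def phiPerm (n k : ℕ) (μ : Equiv.Perm (Fin n)) (ν : Equiv.Perm (Fin k)) :
    Equiv.Perm (StarVertex n k) where
  toFun := phi n k μ ν
  invFun := phi n k μ⁻¹ ν⁻¹
  left_inv a := Subtype.ext (funext fun j => by simp [phi])
  right_inv a := Subtype.ext (funext fun j => by simp [phi])

/-- A subgroup `H ≤ S_n` is `m`-transitive: it acts transitively on the set of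
`m`-permutations (injective `m`-tuples). -/
def IsMultTrans (n m : ℕ) (H : Subgroup (Equiv.Perm (Fin n))) : Prop :=
  ∀ a b : Fin m → Fin n, Function.Injective a → Function.Injective b →
    ∃ μ ∈ H, ∀ j, μ (a j) = b j

/-- A subgroup `H ≤ S_n` is sharply `m`-transitive: it acts regularly on the set of
`m`-permutations (injective `m`-tuples). -/
def IsSharplyMultTrans (n m : ℕ) (H : Subgroup (Equiv.Perm (Fin n))) : Prop :=
  ∀ a b : Fin m → Fin n, Function.Injective a → Function.Injective b →
    ∃! μ : H, ∀ j, (μ : Equiv.Perm (Fin n)) (a j) = b j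

/-- A finite group acting sharply 2-transitively contains at most one fixed-point-free element
mapping a given point to another given point. -/
theorem eq_of_fixedPointFree_of_smul_eq {G X : Type*} [Group G] [MulAction G X] [Fintype X]
    (htrans : ∀ a b c d : X, a ≠ b → c ≠ d → ∃ g : G, g • a = c ∧ g • b = d)
    (hfix : ∀ (g : G) (a b : X), a ≠ b → g • a = a → g • b = b → g = 1)
    {f f' : G} (hf : ∀ x : X, f • x ≠ x) (hf' : ∀ x : X, f' • x ≠ x) {x : X}
    (hff' : f • x = f' • x) : f = f' := by
  classical
  obtain ⟨y, hy⟩ : ∃ y, f • x = y := ⟨_, rfl⟩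
  have hy' : f' • x = y := by rw [← hff', hy]
  have hxy : x ≠ y := fun h => hf x (hy.trans h.symm)
  have eq_of (g g' : G) (a b : X) (hab : a ≠ b) (ha : g • a = g' • a) (hb : g • b = g' • b) :
      g = g' := by
    have := hfix (g'⁻¹ * g) a b hab (by rw [mul_smul, ha, inv_smul_smul])
      (by rw [mul_smul, hb, inv_smul_smul])
    exact (inv_mul_eq_one.mp this).symm
  choose! t htx htz using fun z : X => fun hz : z ≠ x ∧ z ≠ y =>
    htrans x z y z hz.1.symm hz.2.symm
  have hne (g : G) (hg : g • x = y) : g • y ≠ y := fun h =>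
    hxy (MulAction.injective g (hg.trans h.symm))
  have hfixed (g : G) (hg : g • x = y) (hgf : ∀ z : X, g • z ≠ z) (z : X)
      (hz : z ≠ x ∧ z ≠ y) : t z • y ≠ g • y := fun h => by
    have := eq_of (t z) g x y hxy ((htx z hz).trans hg.symm) h
    exact hgf z (this ▸ htz z hz)
  by_contra hne'
  have hyy : f • y ≠ f' • y := fun h => hne' (eq_of f f' x y hxy hff' h)
  let A : Finset X := Finset.univ \ {x, y}
  have hA (z : X) (hz : z ∈ A) : z ≠ x ∧ z ≠ y := by
    simpa [A, not_or] using hz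
  have hinj : Set.InjOn (fun z => t z • y) A := by
    intro z hz w hw hzw
    have hz := hA z hz
    have hw := hA w hw
    have htt := eq_of (t z) (t w) x y hxy ((htx z hz).trans (htx w hw).symm) hzw
    by_contra hzw'
    have h1 := hfix (t z) z w hzw' (htz z hz) (by rw [htt]; exact htz w hw)
    have h2 := htx z hz
    rw [h1, one_smul] at h2
    exact hxy h2
  have hdisj : Disjoint (A.image fun z => t z • y) {f • y, f' • y, y} := by
    rw [Finset.disjoint_left]
    intro w hw hw'
    obtain ⟨z, hz, rfl⟩ := Finset.mem_image.mp hw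
    have hz := hA z hz
    simp only [Finset.mem_insert, Finset.mem_singleton] at hw'
    rcases hw' with h | h | h
    · exact hfixed f hy hf z hz h
    · exact hfixed f' hy' hf' z hz h
    · exact hne _ (htx z hz) h
  have hcard := Finset.card_le_univ ((A.image fun z => t z • y) ∪ {f • y, f' • y, y})
  rw [Finset.card_union_of_disjoint hdisj, Finset.card_image_of_injOn hinj,
    Finset.card_eq_three.mpr ⟨_, _, _, hyy, hne f hy, hne f' hy', rfl⟩,
    Finset.card_sdiff_of_subset (Finset.subset_univ _), Finset.card_pair hxy,
    Finset.card_univ] at hcard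
  have : 2 ≤ Fintype.card X := by
    rw [← Finset.card_pair hxy]
    exact Finset.card_le_univ _
  omega

/-- The degree of a finite sharply 2-transitive group is a prime power. -/
theorem isPrimePow_card_of_sharply_two_transitive {G X : Type*} [Group G] [Finite G]
    [MulAction G X] [Fintype X] (hX : 2 ≤ Fintype.card X)
    (htrans : ∀ a b c d : X, a ≠ b → c ≠ d → ∃ g : G, g • a = c ∧ g • b = d)
    (hfix : ∀ (g : G) (a b : X), a ≠ b → g • a = a → g • b = b → g = 1) :
    IsPrimePow (Fintype.card X) := by
  classical
  have : Nontrivial X := Fintype.one_lt_card_iff_nontrivial.mp hX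
  obtain ⟨x, -⟩ := exists_pair_ne X
  have hpre : MulAction.IsPretransitive G X := by
    refine ⟨fun a c => ?_⟩
    obtain ⟨b, hb⟩ := exists_ne a
    obtain ⟨d, hd⟩ := exists_ne c
    obtain ⟨g, hg, -⟩ := htrans a b c d hb.symm hd.symm
    exact ⟨g, hg⟩
  have hdvd : Fintype.card X ∣ Nat.card G := by
    rw [← Nat.card_eq_fintype_card, ← MulAction.index_stabilizer_of_transitive G x]
    exact Subgroup.index_dvd_card _
  have key (p : ℕ) (hp : p.Prime) (hpX : p ∣ Fintype.card X) :
      ∃ g : G, orderOf g = p ∧ ∀ x : X, g • x ≠ x := by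
    have : Fact p.Prime := ⟨hp⟩
    obtain ⟨g, hg⟩ := exists_prime_orderOf_dvd_card' p (hpX.trans hdvd)
    refine ⟨g, hg, fun z hz => ?_⟩
    have hP : IsPGroup p (Subgroup.zpowers g) :=
      IsPGroup.of_card (n := 1) (by rw [Nat.card_zpowers, hg, pow_one])
    have hmod := hP.card_modEq_card_fixedPoints X
    have hone : MulAction.fixedPoints (Subgroup.zpowers g) X = {z} := by
      ext w
      simp only [MulAction.mem_fixedPoints, Set.mem_singleton_iff]
      constructor
      · intro hw
        by_contra hwz
        have := hfix g w z hwz (hw ⟨g, Subgroup.mem_zpowers g⟩) hz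
        rw [this, orderOf_one] at hg
        exact hp.one_lt.ne hg
      · rintro rfl ⟨h, hh⟩
        have : Subgroup.zpowers g ≤ MulAction.stabilizer G w :=
          (Subgroup.zpowers_le).mpr hz
        exact this hh
    rw [hone, Nat.card_eq_fintype_card, Nat.card_unique] at hmod
    have h1 := (Nat.modEq_zero_iff_dvd.mpr hpX).symm.trans hmod
    exact hp.one_lt.ne' (Nat.dvd_one.mp ((Nat.modEq_zero_iff_dvd).mp h1.symm))
  rw [isPrimePow_iff_unique_prime_dvd]
  obtain ⟨p, hp, hpX⟩ := Nat.exists_prime_and_dvd (n := Fintype.card X) (by omega)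
  refine ⟨p, ⟨hp, hpX⟩, ?_⟩
  rintro q ⟨hq, hqX⟩
  obtain ⟨g, hg, hgf⟩ := key p hp hpX
  obtain ⟨g', hg', hgf'⟩ := key q hq hqX
  obtain ⟨h, hhx, hhg⟩ := htrans x (g • x) x (g' • x) (hgf x).symm (hgf' x).symm
  have hconj : h * g * h⁻¹ = g' := by
    refine eq_of_fixedPointFree_of_smul_eq htrans hfix (x := x) (fun z hz => ?_) hgf' ?_
    · apply hgf (h⁻¹ • z)
      rw [mul_smul, mul_smul] at hz
      rw [eq_inv_smul_iff, hz]
    · rw [mul_smul, mul_smul, inv_smul_eq_iff.mpr hhx.symm, hhg]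
  rw [← hg, ← hg', ← hconj]
  exact orderOf_injective (MulAut.conj h).toMonoidHom (MulAut.conj h).injective g

/-- The vertex `[a, b]` of `S_{n,2}`. -/
def StarVertex.pair {n : ℕ} (a b : Fin n) (h : a ≠ b) : StarVertex n 2 :=
  ⟨![a, b], by
    intro i j hij
    fin_cases i <;> fin_cases j <;> simp_all⟩

theorem StarVertex.ext_two {n : ℕ} {u v : StarVertex n 2} (h0 : u.1 0 = v.1 0)
    (h1 : u.1 1 = v.1 1) : u = v := by
  refine Subtype.ext (funext fun i => ?_)
  fin_cases i
  · exact h0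
  · exact h1

theorem StarVertex.zero_ne_one {n : ℕ} (u : StarVertex n 2) : u.1 0 ≠ u.1 1 :=
  fun h => absurd (u.2 h) (by decide)

theorem starGraph_two_adj {n : ℕ} (u v : StarVertex n 2) :
    (starGraph n 2).Adj u v ↔
      (u.1 0 = v.1 1 ∧ u.1 1 = v.1 0) ∨ (u.1 0 ≠ v.1 0 ∧ u.1 1 = v.1 1) := by
  have hu := u.zero_ne_one
  have hv := v.zero_ne_one
  have huv : u = v ↔ u.1 0 = v.1 0 ∧ u.1 1 = v.1 1 :=
    ⟨fun h => by simp [h], fun h => StarVertex.ext_two h.1 h.2⟩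
  rw [starGraph, SimpleGraph.fromRel_adj, Ne, huv]
  simp only [IsStarEdge, IsResEdge, Fin.forall_fin_two, Fin.exists_fin_two]
  simp
  grind

theorem starGraph_two_exists_common_adj_iff {n : ℕ} (hn : 4 ≤ n) {u v : StarVertex n 2}
    (h : (starGraph n 2).Adj u v) :
    (∃ w, (starGraph n 2).Adj u w ∧ (starGraph n 2).Adj v w) ↔ u.1 1 = v.1 1 := by
  constructor
  · rintro ⟨w, huw, hvw⟩
    have hu := u.zero_ne_one
    have hv := v.zero_ne_one
    have hw := w.zero_ne_one
    rw [starGraph_two_adj] at h huw hvw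
    grind
  · intro h1
    obtain ⟨c, hc⟩ : ∃ c : Fin n, c ∉ ({u.1 0, v.1 0, u.1 1} : Finset (Fin n)) := by
      by_contra! hall
      have h2 := Finset.card_le_card (fun c _ => hall c :
        (Finset.univ : Finset (Fin n)) ⊆ {u.1 0, v.1 0, u.1 1})
      have h3 := Finset.card_le_three (a := u.1 0) (b := v.1 0) (c := u.1 1)
      rw [Finset.card_univ, Fintype.card_fin] at h2
      omega
    simp only [Finset.mem_insert, Finset.mem_singleton, not_or] at hc
    refine ⟨StarVertex.pair c (u.1 1) hc.2.2, ?_, ?_⟩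
    · rw [starGraph_two_adj]
      exact Or.inr ⟨Ne.symm hc.1, rfl⟩
    · rw [starGraph_two_adj]
      exact Or.inr ⟨Ne.symm hc.2.1, h1.symm⟩

/-- Every automorphism of `S_{n,2}`, `n ≥ 4`, is induced by a map on the symbols. -/
theorem exists_symbol_map {n : ℕ} (hn : 4 ≤ n) (σ : starGraph n 2 ≃g starGraph n 2) :
    ∃ μ : Fin n → Fin n, ∀ v, (σ v).1 0 = μ (v.1 0) ∧ (σ v).1 1 = μ (v.1 1) := by
  have hcommon (u v : StarVertex n 2) :
      (∃ w, (starGraph n 2).Adj (σ u) w ∧ (starGraph n 2).Adj (σ v) w) ↔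
        ∃ w, (starGraph n 2).Adj u w ∧ (starGraph n 2).Adj v w := by
    refine σ.surjective.exists.trans ?_
    simp only [σ.map_adj_iff]
  have hsnd (u v : StarVertex n 2) (h : u.1 1 = v.1 1) : (σ u).1 1 = (σ v).1 1 := by
    by_cases h0 : u.1 0 = v.1 0
    · rw [StarVertex.ext_two h0 h]
    · have hadj : (starGraph n 2).Adj u v := (starGraph_two_adj u v).mpr (Or.inr ⟨h0, h⟩)
      rwa [← starGraph_two_exists_common_adj_iff hn (σ.map_adj_iff.mpr hadj), hcommon,
        starGraph_two_exists_common_adj_iff hn hadj]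
  have hswap (u v : StarVertex n 2) (h0 : u.1 0 = v.1 1) (h1 : u.1 1 = v.1 0) :
      (σ u).1 0 = (σ v).1 1 := by
    have hadj : (starGraph n 2).Adj u v := (starGraph_two_adj u v).mpr (Or.inl ⟨h0, h1⟩)
    have hadj' := σ.map_adj_iff.mpr hadj
    have hne : (σ u).1 1 ≠ (σ v).1 1 := by
      rw [Ne, ← starGraph_two_exists_common_adj_iff hn hadj', hcommon,
        starGraph_two_exists_common_adj_iff hn hadj, h1]
      exact v.zero_ne_one
    rcases (starGraph_two_adj _ _).mp hadj' with h | h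
    · exact h.1
    · exact absurd h.2 hne
  have : Nontrivial (Fin n) := Fin.nontrivial_iff_two_le.mpr (by omega)
  choose x hx using fun b : Fin n => exists_ne b
  refine ⟨fun b => (σ (StarVertex.pair (x b) b (hx b))).1 1, fun v => ⟨?_, hsnd _ _ rfl⟩⟩
  rw [hswap v (StarVertex.pair (v.1 1) (v.1 0) v.zero_ne_one.symm) rfl rfl]
  exact hsnd _ _ rfl

theorem isPrimePow_of_isCayleyGraph {n : ℕ} (hn : 4 ≤ n) (h : IsCayleyGraph (starGraph n 2)) :
    IsPrimePow n := by
  obtain ⟨G, _, _, S, -, -, ⟨φ⟩⟩ := h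
  let L (g : G) : starGraph n 2 ≃g starGraph n 2 :=
    { toEquiv := (φ.toEquiv.trans (Equiv.mulLeft g)).trans φ.toEquiv.symm
      map_rel_iff' := by
        intro u v
        have h1 := φ.symm.map_adj_iff (v := g * φ u) (w := g * φ v)
        have h2 := φ.map_adj_iff (v := u) (w := v)
        refine Iff.trans (Iff.trans h1 ?_) h2
        simp [SimpleGraph.fromRel_adj, mul_assoc] }
  have hL (g : G) (v : StarVertex n 2) : L g v = φ.symm (g * φ v) := rfl
  choose μ hμ using fun g => exists_symbol_map hn (L g)
  have : Nontrivial (Fin n) := Fin.nontrivial_iff_two_le.mpr (by omega)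
  have hμ0 (g : G) (a b : Fin n) (hab : a ≠ b) :
      (L g (StarVertex.pair a b hab)).1 0 = μ g a := (hμ g _).1
  let act : MulAction G (Fin n) :=
    { smul := μ
      one_smul := by
        intro a
        obtain ⟨b, hb⟩ := exists_ne a
        have h1 := hμ0 1 a b hb.symm
        rw [hL, one_mul, φ.symm_apply_apply] at h1
        exact h1.symm
      mul_smul := by
        intro g h a
        obtain ⟨b, hb⟩ := exists_ne a
        have h1 := hμ0 (g * h) a b hb.symm
        have h2 : L (g * h) (StarVertex.pair a b hb.symm) =
            L g (L h (StarVertex.pair a b hb.symm)) := by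
          simp [hL, mul_assoc]
        rw [h2, (hμ g _).1, hμ0] at h1
        exact h1.symm }
  have hsmul (g : G) (a : Fin n) : g • a = μ g a := rfl
  have hpp := isPrimePow_card_of_sharply_two_transitive (G := G) (X := Fin n)
    (by rw [Fintype.card_fin]; omega) ?_ ?_
  · rwa [Fintype.card_fin] at hpp
  · intro a b c d hab hcd
    let u := StarVertex.pair a b hab
    let v := StarVertex.pair c d hcd
    have huv : L (φ v * (φ u)⁻¹) u = v := by simp [hL]
    have h := hμ (φ v * (φ u)⁻¹) u
    rw [huv] at h
    exact ⟨φ v * (φ u)⁻¹, h.1.symm, h.2.symm⟩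
  · intro g a b hab ha hb
    have h := hμ g (StarVertex.pair a b hab)
    have h1 : L g (StarVertex.pair a b hab) = StarVertex.pair a b hab :=
      StarVertex.ext_two (h.1.trans ha) (h.2.trans hb)
    rw [hL] at h1
    have h2 := congrArg φ h1
    rw [φ.apply_symm_apply] at h2
    exact mul_eq_right.mp h2

/-- A finite group acting sharply 2-transitively on `n ≥ 2` points realises `S_{n,2}` as a
Cayley graph. -/
theorem isCayleyGraph_of_sharply_two_transitive {n : ℕ} (hn : 2 ≤ n) {G : Type} {X : Type*}
    [Group G] [Finite G] [MulAction G X] (e : X ≃ Fin n)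
    (htrans : ∀ a b c d : X, a ≠ b → c ≠ d → ∃ g : G, g • a = c ∧ g • b = d)
    (hfix : ∀ (g : G) (a b : X), a ≠ b → g • a = a → g • b = b → g = 1) :
    IsCayleyGraph (starGraph n 2) := by
  have : Nontrivial (Fin n) := Fin.nontrivial_iff_two_le.mpr hn
  have := e.nontrivial
  obtain ⟨a, b, hab⟩ := exists_pair_ne X
  let Φ (g : G) : StarVertex n 2 := StarVertex.pair (e (g • a)) (e (g • b))
    fun h => hab (MulAction.injective g (e.injective h))
  have hΦ0 (g : G) : (Φ g).1 0 = e (g • a) := rfl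
  have hΦ1 (g : G) : (Φ g).1 1 = e (g • b) := rfl
  have hinj : Function.Injective Φ := by
    intro g h hgh
    have h0 : g • a = h • a := e.injective (by rw [← hΦ0, hgh, hΦ0])
    have h1 : g • b = h • b := e.injective (by rw [← hΦ1, hgh, hΦ1])
    exact (inv_mul_eq_one.mp (hfix (h⁻¹ * g) a b hab (by rw [mul_smul, h0, inv_smul_smul])
      (by rw [mul_smul, h1, inv_smul_smul]))).symm
  have hsurj : Function.Surjective Φ := by
    intro v
    obtain ⟨g, h0, h1⟩ := htrans a b (e.symm (v.1 0)) (e.symm (v.1 1)) hab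
      (fun h => v.zero_ne_one (e.symm.injective h))
    exact ⟨g, StarVertex.ext_two (by rw [hΦ0, h0, e.apply_symm_apply])
      (by rw [hΦ1, h1, e.apply_symm_apply])⟩
  have hadj (k g h : G) : (starGraph n 2).Adj (Φ (k * g)) (Φ (k * h)) ↔
      (starGraph n 2).Adj (Φ g) (Φ h) := by
    simp only [starGraph_two_adj, hΦ0, hΦ1, mul_smul, e.injective.eq_iff, ne_eq,
      (MulAction.injective k).eq_iff]
  have hadj1 (g h : G) : (starGraph n 2).Adj (Φ 1) (Φ (g⁻¹ * h)) ↔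
      (starGraph n 2).Adj (Φ g) (Φ h) := by
    rw [← hadj g, mul_one, mul_inv_cancel_left]
  refine ⟨G, inferInstance, Fintype.ofFinite G, {s | (starGraph n 2).Adj (Φ 1) (Φ s)},
    (starGraph n 2).irrefl, fun s hs => ?_, ⟨RelIso.symm
      { toEquiv := Equiv.ofBijective Φ ⟨hinj, hsurj⟩
        map_rel_iff' := ?_ }⟩⟩
  · have h := (hadj1 s 1).mpr (SimpleGraph.Adj.symm hs)
    rwa [mul_one] at h
  · intro g h
    simp only [SimpleGraph.fromRel_adj, Set.mem_ofPred_eq, hadj1]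
    constructor
    · intro hgh
      exact ⟨fun h' => hgh.ne (congrArg Φ h'), Or.inl hgh⟩
    · rintro ⟨-, hgh | hgh⟩
      · exact hgh
      · exact hgh.symm

theorem exists_affineEquiv_apply_eq {F : Type*} [Field F] {a b c d : F} (hab : a ≠ b)
    (hcd : c ≠ d) : ∃ g : F ≃ᵃ[F] F, g a = c ∧ g b = d := by
  have hba : b - a ≠ 0 := sub_ne_zero.mpr hab.symm
  have hdc : d - c ≠ 0 := sub_ne_zero.mpr hcd.symm
  have hr : (d - c) / (b - a) ≠ 0 := div_ne_zero hdc hba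
  refine ⟨AffineEquiv.mk' (fun x => (d - c) / (b - a) * (x - a) + c)
    (LinearEquiv.smulOfNeZero F F _ hr) a (fun x => by simp), ?_, ?_⟩
  · change (d - c) / (b - a) * (a - a) + c = c
    simp
  · change (d - c) / (b - a) * (b - a) + c = d
    field_simp
    ring

theorem affineEquiv_eq_one_of_fixes {F : Type*} [Field F] (g : F ≃ᵃ[F] F) {a b : F}
    (hab : a ≠ b) (ha : g a = a) (hb : g b = b) : g = 1 := by
  ext x
  have hba : b - a ≠ 0 := sub_ne_zero.mpr hab.symm
  have hx : x = AffineMap.lineMap a b ((x - a) / (b - a)) := by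
    rw [AffineMap.lineMap_apply_ring']
    field_simp
    ring
  rw [hx, AffineEquiv.apply_lineMap, ha, hb]
  rfl

theorem isCayleyGraph_of_isPrimePow {n : ℕ} (h : IsPrimePow n) :
    IsCayleyGraph (starGraph n 2) := by
  have hn := h.two_le
  obtain ⟨p, k, hp, hk, rfl⟩ := (isPrimePow_nat_iff _).mp h
  have : Fact p.Prime := ⟨hp⟩
  let F := GaloisField p k
  let e : F ≃ Fin (p ^ k) := Finite.equivFinOfCardEq (GaloisField.card p k hk.ne')
  have : Finite (F ≃ᵃ[F] F) := Finite.of_injective _ (DFunLike.coe_injective (F := F ≃ᵃ[F] F))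
  let act : MulAction (F ≃ᵃ[F] F) F :=
    { smul := fun g x => g x
      one_smul := fun _ => rfl
      mul_smul := fun _ _ _ => rfl }
  exact isCayleyGraph_of_sharply_two_transitive hn (G := F ≃ᵃ[F] F) e
    (fun _ _ _ _ => exists_affineEquiv_apply_eq)
    (fun g _ _ => affineEquiv_eq_one_of_fixes g)

/-- For every `n ≥ 4`, the `(n,2)`-star graph `S_{n,2}` is a Cayley graph if and only if
`n` is a prime power. -/
theorem star_graph_two_cayley_iff (n : ℕ) (hn : 4 ≤ n) :
    IsCayleyGraph (starGraph n 2) ↔ IsPrimePow n := by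
  exact ⟨isPrimePow_of_isCayleyGraph hn, isCayleyGraph_of_isPrimePow⟩
end

section
/- For every integer n ≥ 5, the (n,3)-star graph S_{n,3} is a Cayley graph if and only if n−1 is a prime power. -/
open Equiv

/-! ### Groups in which only the identity fixes two points -/

section TwoHomogeneous

variable {L X : Type*} [Group L] [Finite L] [Finite X] [MulAction L X]

theorem card_fixedPointFree_lt [MulAction.IsPretransitive L X] [Nonempty X]
    (free : ∀ (l : L) (x y : X), x ≠ y → l • x = x → l • y = y → l = 1) :
    Nat.card {g : L // ∀ x : X, g • x ≠ x} < Nat.card X := by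
  classical
  have := Fintype.ofFinite L
  have := Fintype.ofFinite X
  have hone : Fintype.card (MulAction.orbitRel.Quotient L X) = 1 := by
    have := (MulAction.pretransitive_iff_subsingleton_quotient L X).1 inferInstance
    have : Nonempty (MulAction.orbitRel.Quotient L X) := ‹Nonempty X›.map (Quotient.mk _)
    exact Fintype.card_eq_one_iff_nonempty_unique.2 ⟨⟨⟨this.some⟩, fun _ => Subsingleton.elim _ _⟩⟩
  have burnside := MulAction.sum_card_fixedBy_eq_card_orbits_mul_card_group L X
  rw [hone, one_mul] at burnside
  have hle : ∀ g : L, 1 ≤ Fintype.card (MulAction.fixedBy X g) +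
      if (∀ x : X, g • x ≠ x) then 1 else 0 := by
    intro g
    split_ifs with h
    · omega
    · push Not at h
      obtain ⟨x, hx⟩ := h
      have : 0 < Fintype.card (MulAction.fixedBy X g) := Fintype.card_pos_iff.2 ⟨⟨x, hx⟩⟩
      omega
  have hge : ∀ g : L, g ≠ 1 → Fintype.card (MulAction.fixedBy X g) +
      (if (∀ x : X, g • x ≠ x) then 1 else 0) ≤ 1 := by
    intro g hg
    split_ifs with h
    · have : IsEmpty (MulAction.fixedBy X g) := ⟨fun x => h x.1 x.2⟩
      simp
    · rw [add_zero, Fintype.card_le_one_iff]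
      intro a b
      by_contra hab
      exact hg (free g a.1 b.1 (fun h => hab (Subtype.ext h)) a.2 b.2)
  have hsum : ∑ g : L, (Fintype.card (MulAction.fixedBy X g) +
      if (∀ x : X, g • x ≠ x) then 1 else 0) + 1 ≤ Fintype.card X + Fintype.card L := by
    rw [← Finset.add_sum_erase _ _ (Finset.mem_univ (1 : L))]
    have h1 := Finset.sum_le_card_nsmul (Finset.univ.erase (1 : L)) _ 1
      (fun g hg => hge g (Finset.ne_of_mem_erase hg))
    rw [Finset.card_erase_of_mem (Finset.mem_univ _), Finset.card_univ, smul_eq_mul, mul_one] at h1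
    have h2 : ¬ ∀ x : X, (1 : L) • x ≠ x := fun h => h (Classical.arbitrary X) (one_smul _ _)
    have h3 : Fintype.card (MulAction.fixedBy X (1 : L)) = Fintype.card X := by
      rw [← Fintype.card_congr (Equiv.Set.univ X)]
      exact Fintype.card_congr (Equiv.setCongr (by ext; simp))
    have h4 : 0 < Fintype.card L := Fintype.card_pos
    rw [if_neg h2, h3]
    omega
  rw [Finset.sum_add_distrib, burnside, Finset.sum_boole, Nat.cast_id] at hsum
  rw [Nat.card_eq_fintype_card, Nat.card_eq_fintype_card, Fintype.card_subtype]
  omega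

omit [Finite L] in
theorem fixedPointFree_of_orderOf_prime
    (free : ∀ (l : L) (x y : X), x ≠ y → l • x = x → l • y = y → l = 1)
    {p : ℕ} (hp : p.Prime) (hpX : p ∣ Nat.card X) {g : L} (hg : orderOf g = p) (x : X) :
    g • x ≠ x := by
  classical
  have := Fintype.ofFinite X
  intro hx
  have : Fact p.Prime := ⟨hp⟩
  have hf : (g • · : X → X)^[p ^ 1] = id := by
    funext y
    rw [smul_iterate, pow_one, ← hg, pow_orderOf_eq_one]
    exact one_smul L y
  have hmod := Equiv.Perm.card_fixedPoints_modEq (f := (g • · : X → X)) (p := p) (n := 1) hf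
  have hpos : 0 < Fintype.card (Function.fixedPoints (g • · : X → X)) :=
    Fintype.card_pos_iff.2 ⟨⟨x, hx⟩⟩
  rw [Nat.card_eq_fintype_card] at hpX
  have hdvd : p ∣ Fintype.card (Function.fixedPoints (g • · : X → X)) :=
    (Nat.modEq_zero_iff_dvd.1 (hmod.symm.trans (Nat.modEq_zero_iff_dvd.2 hpX)))
  have h1 : 1 < Fintype.card (Function.fixedPoints (g • · : X → X)) :=
    lt_of_lt_of_le hp.one_lt (Nat.le_of_dvd hpos hdvd)
  obtain ⟨y, hy⟩ := Fintype.exists_ne_of_one_lt_card h1 ⟨x, hx⟩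
  have hg1 := free g x y.1 (fun h => hy (Subtype.ext h.symm)) hx y.2
  rw [hg1, orderOf_one] at hg
  exact hp.one_lt.ne hg

theorem card_le_card_orderOf_add_one
    (free : ∀ (l : L) (x y : X), x ≠ y → l • x = x → l • y = y → l = 1)
    (homog : ∀ a b c d : X, a ≠ b → c ≠ d →
      ∃ l : L, (l • a = c ∧ l • b = d) ∨ (l • a = d ∧ l • b = c))
    {g : L} (hg : ∀ x : X, g • x ≠ x) :
    Nat.card X ≤ Nat.card {h : L // orderOf h = orderOf g} + 1 := by
  classical
  rcases subsingleton_or_nontrivial X with hX | ⟨x, y, hxy⟩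
  · exact (Finite.card_le_one_iff_subsingleton.2 hX).trans (Nat.le_add_left _ _)
  have hcard : Nat.card X = Nat.card {z : X // z ≠ x} + 1 := by
    have := Fintype.ofFinite X
    rw [Nat.card_eq_fintype_card, Nat.card_eq_fintype_card, Fintype.card_subtype_compl,
      Fintype.card_subtype_eq]
    have : 0 < Fintype.card X := Fintype.card_pos_iff.2 ⟨x⟩
    omega
  rw [hcard, add_le_add_iff_right]
  have comm : ∀ h : L, h • x = x → h * g = g * h → h = 1 := fun h hx hc =>
    free h x (g • x) (hg x).symm hx (by rw [← mul_smul, hc, mul_smul, hx])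
  have hconj : ∀ h k : L, orderOf (h * k * h⁻¹) = orderOf k := fun h k => by
    rw [← MulAut.conj_apply, MulEquiv.orderOf_eq]
  have key : ∀ h k : MulAction.stabilizer L x,
      h.1 * g * h.1⁻¹ = k.1 * g * k.1⁻¹ → h = k := by
    intro h k hk
    have hx : (k⁻¹ * h).1 • x = x := (k⁻¹ * h).2
    have := comm _ hx (by
      simp only [Subgroup.coe_mul, Subgroup.coe_inv]
      calc k.1⁻¹ * h.1 * g = k.1⁻¹ * (h.1 * g * h.1⁻¹) * h.1 := by group
        _ = g * (k.1⁻¹ * h.1) := by rw [hk]; group)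
    have h2 : k⁻¹ * h = 1 := Subtype.ext this
    exact (inv_mul_eq_one.1 h2).symm
  by_cases hswap : ∃ (l : L) (a b : X), a ≠ b ∧ l • a = b ∧ l • b = a
  · obtain ⟨t, a, b, hab, hta, htb⟩ := hswap
    have trans2 : ∀ c d : X, c ≠ d → ∃ l : L, l • a = c ∧ l • b = d := by
      intro c d hcd
      obtain ⟨l, hl | hl⟩ := homog a b c d hab hcd
      · exact ⟨l, hl⟩
      · exact ⟨l * t, by rw [mul_smul, hta, hl.2], by rw [mul_smul, htb, hl.1]⟩
    have hsurj : Function.Surjective (fun h : MulAction.stabilizer L x =>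
        (⟨h.1 • y, fun e => hxy (by
          have : h.1 • x = x := h.2
          exact (MulAction.injective h.1 (e.trans this.symm)).symm)⟩ : {z : X // z ≠ x})) := by
      rintro ⟨z, hz⟩
      obtain ⟨l, hla, hlb⟩ := trans2 x y hxy
      obtain ⟨k, hka, hkb⟩ := trans2 x z hz.symm
      refine ⟨⟨k * l⁻¹, ?_⟩, Subtype.ext ?_⟩
      · rw [MulAction.mem_stabilizer_iff, mul_smul, inv_smul_eq_iff.2 hla.symm, hka]
      · change (k * l⁻¹) • y = z
        rw [mul_smul, inv_smul_eq_iff.2 hlb.symm, hkb]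
    have hinj : Function.Injective (fun h : MulAction.stabilizer L x =>
        (⟨h.1 * g * h.1⁻¹, hconj _ _⟩ : {h : L // orderOf h = orderOf g})) :=
      fun h k hk => key h k (congrArg Subtype.val hk)
    exact (Nat.card_le_card_of_surjective _ hsurj).trans (Nat.card_le_card_of_injective _ hinj)
  · push Not at hswap
    have noinv : ∀ (h : L) (z : X), h * h = 1 → h • z = z := by
      intro h z hh
      by_contra hz
      exact hswap h z (h • z) (Ne.symm hz) rfl (by rw [← mul_smul, hh, one_smul])
    obtain ⟨r, hr⟩ : ∃ r : L, r • y = x := by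
      obtain ⟨k, hk | hk⟩ := homog x y x (g • x) hxy (hg x).symm
      · exact ⟨g⁻¹ * k, by rw [mul_smul, hk.2, inv_smul_smul]⟩
      · exact ⟨k, hk.2⟩
    have hrx : r • x ≠ x := fun e => hxy (MulAction.injective r (e.trans hr.symm))
    have hstab : ∀ (h : MulAction.stabilizer L x) (z : X), z ≠ x → h.1 • z ≠ x := by
      intro h z hz e
      have : h.1 • x = x := h.2
      exact hz (MulAction.injective h.1 (e.trans this.symm))
    have hsurj : Function.Surjective (fun h : MulAction.stabilizer L x × Bool =>
        (⟨h.1.1 • (if h.2 then y else r • x), hstab _ _ (by split_ifs; exacts [hxy.symm, hrx])⟩ :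
          {z : X // z ≠ x})) := by
      rintro ⟨z, hz⟩
      obtain ⟨l, hl | hl⟩ := homog x y x z hxy hz.symm
      · exact ⟨⟨⟨l, hl.1⟩, true⟩, Subtype.ext hl.2⟩
      · refine ⟨⟨⟨l * r⁻¹, ?_⟩, false⟩, Subtype.ext ?_⟩
        · rw [MulAction.mem_stabilizer_iff, mul_smul, inv_smul_eq_iff.2 hr.symm, hl.2]
        · change (l * r⁻¹) • (r • x) = z
          rw [mul_smul, inv_smul_smul, hl.1]
    have key' : ∀ h k : MulAction.stabilizer L x,
        h.1 * g * h.1⁻¹ ≠ k.1 * g⁻¹ * k.1⁻¹ := by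
      intro h k hk
      have hx : (k⁻¹ * h).1 • x = x := (k⁻¹ * h).2
      set w : L := (k⁻¹ * h).1 with hw
      have hwg : w * g * w⁻¹ = g⁻¹ := by
        calc w * g * w⁻¹ = k.1⁻¹ * (h.1 * g * h.1⁻¹) * k.1 := by
              simp only [hw, Subgroup.coe_mul, Subgroup.coe_inv]; group
          _ = g⁻¹ := by rw [hk]; group
      have hww : w * w = 1 := comm _ (by rw [mul_smul, hx, hx]) (by
        calc w * w * g = w * (w * g * w⁻¹) * w := by group
          _ = w * g⁻¹ * w := by rw [hwg]
          _ = (w * g * w⁻¹)⁻¹ * (w * w) := by group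
          _ = g * (w * w) := by rw [hwg, inv_inv])
      have hw1 : w = 1 := free w x y hxy hx (noinv w y hww)
      rw [hw1, one_mul, inv_one, mul_one] at hwg
      exact hg x (noinv g x (by nth_rewrite 1 [hwg]; exact inv_mul_cancel g))
    have hinj : Function.Injective (fun h : MulAction.stabilizer L x × Bool =>
        (⟨h.1.1 * (if h.2 then g else g⁻¹) * h.1.1⁻¹, by
          rw [hconj]; split_ifs; exacts [rfl, orderOf_inv g]⟩ :
            {h : L // orderOf h = orderOf g})) := by
      rintro ⟨h, i⟩ ⟨k, j⟩ hk
      have hk' := congrArg Subtype.val hk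
      cases i <;> cases j <;> simp only [if_true, Bool.false_eq_true, if_false] at hk'
      · rw [key h k (by simpa [mul_assoc] using congrArg (·⁻¹) hk')]
      · exact absurd hk'.symm (key' k h)
      · exact absurd hk' (key' h k)
      · rw [key h k hk']
    exact (Nat.card_le_card_of_surjective _ hsurj).trans (Nat.card_le_card_of_injective _ hinj)

theorem isPrimePow_card_of_twoHomogeneous (hX : 2 < Nat.card X)
    (free : ∀ (l : L) (x y : X), x ≠ y → l • x = x → l • y = y → l = 1)
    (homog : ∀ a b c d : X, a ≠ b → c ≠ d →
      ∃ l : L, (l • a = c ∧ l • b = d) ∨ (l • a = d ∧ l • b = c)) :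
    IsPrimePow (Nat.card X) := by
  classical
  have := Fintype.ofFinite X
  have hX' : 2 < Fintype.card X := by rwa [Nat.card_eq_fintype_card] at hX
  have : Nonempty X := Fintype.card_pos_iff.1 (by omega)
  have htrans : MulAction.IsPretransitive L X := by
    refine ⟨fun x y => ?_⟩
    by_cases hxy : x = y
    · exact ⟨1, by rw [one_smul, hxy]⟩
    obtain ⟨z, hz⟩ := Finset.exists_mem_notMem_of_card_lt_card
      (s := {x, y}) (t := Finset.univ) (by
        rw [Finset.card_univ]; exact lt_of_le_of_lt Finset.card_le_two hX')
    simp only [Finset.mem_univ, Finset.mem_insert, Finset.mem_singleton, not_or, true_and] at hz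
    obtain ⟨l, hl | hl⟩ := homog x z y z (Ne.symm hz.1) (Ne.symm hz.2)
    · exact ⟨l, hl.1⟩
    · exact ⟨l * l, by rw [mul_smul, hl.1, hl.2]⟩
  have hord : ∀ p : ℕ, p.Prime → p ∣ Nat.card X → ∃ g : L, orderOf g = p := by
    intro p hp hpX
    have : Fact p.Prime := ⟨hp⟩
    apply exists_prime_orderOf_dvd_card' p
    obtain ⟨x⟩ := ‹Nonempty X›
    rw [← Subgroup.card_mul_index (MulAction.stabilizer L x), MulAction.index_stabilizer,
      MulAction.orbit_eq_univ, Set.ncard_univ]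
    exact hpX.mul_left _
  have hbound : ∀ p : ℕ, p.Prime → p ∣ Nat.card X →
      Nat.card X ≤ Nat.card {h : L // orderOf h = p} + 1 := by
    intro p hp hpX
    obtain ⟨g, rfl⟩ := hord p hp hpX
    exact card_le_card_orderOf_add_one free homog
      (fixedPointFree_of_orderOf_prime free hp hpX rfl)
  rw [isPrimePow_iff_unique_prime_dvd]
  obtain ⟨p, hp, hpX⟩ := Nat.exists_prime_and_dvd (n := Nat.card X) (by omega)
  refine ⟨p, ⟨hp, hpX⟩, ?_⟩
  rintro q ⟨hq, hqX⟩
  by_contra hqp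
  have hlt := card_fixedPointFree_lt (L := L) (X := X) free
  have hinj : Function.Injective
      (Sum.elim (fun h => ⟨h.1, fixedPointFree_of_orderOf_prime free hp hpX h.2⟩)
        (fun h => ⟨h.1, fixedPointFree_of_orderOf_prime free hq hqX h.2⟩) :
        {h : L // orderOf h = p} ⊕ {h : L // orderOf h = q} →
          {g : L // ∀ x : X, g • x ≠ x}) := by
    refine Function.Injective.sumElim ?_ ?_ ?_
    · exact fun h k hk => Subtype.ext (Subtype.mk.inj hk)
    · exact fun h k hk => Subtype.ext (Subtype.mk.inj hk)
    · intro h k hk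
      have : h.1 = k.1 := congrArg Subtype.val hk
      exact hqp (by rw [← h.2, ← k.2, this])
  have hle := Nat.card_le_card_of_injective _ hinj
  rw [Nat.card_sum] at hle
  have := hbound p hp hpX
  have := hbound q hq hqX
  omega

end TwoHomogeneous

/-! ### Automorphisms of the star graph `S_{n,3}` -/

namespace StarVertex

variable {n : ℕ}

theorem ext_iff_three {u v : StarVertex n 3} :
    u = v ↔ u.1 0 = v.1 0 ∧ u.1 1 = v.1 1 ∧ u.1 2 = v.1 2 := by
  constructor
  · rintro rfl
    simp
  · rintro ⟨h0, h1, h2⟩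
    refine Subtype.ext (funext fun j => ?_)
    fin_cases j <;> assumption

theorem zero_ne_one_s15 (u : StarVertex n 3) : u.1 0 ≠ u.1 1 := u.2.ne (by decide)

theorem zero_ne_two (u : StarVertex n 3) : u.1 0 ≠ u.1 2 := u.2.ne (by decide)

theorem one_ne_two (u : StarVertex n 3) : u.1 1 ≠ u.1 2 := u.2.ne (by decide)

/-- The vertex `[a, b, c]`. -/
def triple (a b c : Fin n) (hab : a ≠ b) (hac : a ≠ c) (hbc : b ≠ c) : StarVertex n 3 :=
  ⟨![a, b, c], by
    intro i j hij
    fin_cases i <;> fin_cases j <;> simp_all [eq_comm]⟩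

section triple

variable (a b c : Fin n) (hab : a ≠ b) (hac : a ≠ c) (hbc : b ≠ c)

@[simp] theorem triple_zero : (triple a b c hab hac hbc).1 0 = a := rfl

@[simp] theorem triple_one : (triple a b c hab hac hbc).1 1 = b := rfl

@[simp] theorem triple_two : (triple a b c hab hac hbc).1 2 = c := rfl

end triple

/-- Exchange of the first and second entries. -/
def swapSnd (u : StarVertex n 3) : StarVertex n 3 :=
  triple (u.1 1) (u.1 0) (u.1 2) u.zero_ne_one_s15.symm u.one_ne_two u.zero_ne_two

/-- Exchange of the first and third entries. -/
def swapThd (u : StarVertex n 3) : StarVertex n 3 :=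
  triple (u.1 2) (u.1 1) (u.1 0) u.one_ne_two.symm u.zero_ne_two.symm u.zero_ne_one_s15.symm

/-- Exchange of the second and third entries. -/
def twist (u : StarVertex n 3) : StarVertex n 3 :=
  triple (u.1 0) (u.1 2) (u.1 1) u.zero_ne_two u.zero_ne_one_s15 u.one_ne_two.symm

/-- The action of a permutation of the symbols on the vertices. -/
def relabel (σ : Perm (Fin n)) (u : StarVertex n 3) : StarVertex n 3 :=
  triple (σ (u.1 0)) (σ (u.1 1)) (σ (u.1 2)) (σ.injective.ne u.zero_ne_one_s15)
    (σ.injective.ne u.zero_ne_two) (σ.injective.ne u.one_ne_two)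

theorem swapSnd_swapSnd (u : StarVertex n 3) : swapSnd (swapSnd u) = u := by
  simp [ext_iff_three, swapSnd]

theorem swapThd_swapThd (u : StarVertex n 3) : swapThd (swapThd u) = u := by
  simp [ext_iff_three, swapThd]

theorem twist_twist (u : StarVertex n 3) : twist (twist u) = u := by
  simp [ext_iff_three, twist]

theorem swapSnd_ne_swapThd (u : StarVertex n 3) : swapSnd u ≠ swapThd u := by
  have := u.one_ne_two
  simp [ext_iff_three, swapSnd, swapThd, this]

theorem isResEdge_iff {u v : StarVertex n 3} :
    IsResEdge u v ↔ u.1 0 ≠ v.1 0 ∧ u.1 1 = v.1 1 ∧ u.1 2 = v.1 2 := by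
  simp [IsResEdge, Fin.forall_fin_succ]

theorem isStarEdge_iff {u v : StarVertex n 3} :
    IsStarEdge u v ↔ v = swapSnd u ∨ v = swapThd u := by
  simp [IsStarEdge, Fin.forall_fin_succ, Fin.exists_fin_succ, ext_iff_three, swapSnd, swapThd]
  grind

theorem IsResEdge.symm {u v : StarVertex n 3} (h : IsResEdge u v) : IsResEdge v u := by
  rw [isResEdge_iff] at *
  exact ⟨h.1.symm, h.2.1.symm, h.2.2.symm⟩

theorem starGraph_adj_iff {u v : StarVertex n 3} :
    (starGraph n 3).Adj u v ↔ v = swapSnd u ∨ v = swapThd u ∨ IsResEdge u v := by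
  have := u.zero_ne_one_s15
  have := u.zero_ne_two
  rw [starGraph, SimpleGraph.fromRel_adj]
  simp only [isStarEdge_iff, isResEdge_iff, ext_iff_three, swapSnd, swapThd, triple_zero,
    triple_one, triple_two, ne_eq]
  grind

theorem exists_ne_of_five_le (hn : 5 ≤ n) (a b c d : Fin n) :
    ∃ e : Fin n, e ≠ a ∧ e ≠ b ∧ e ≠ c ∧ e ≠ d := by
  obtain ⟨e, -, he⟩ := Finset.exists_mem_notMem_of_card_lt_card
    (s := {a, b, c, d}) (t := Finset.univ) (by
      rw [Finset.card_univ, Fintype.card_fin]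
      exact lt_of_le_of_lt Finset.card_le_four hn)
  simp only [Finset.mem_insert, Finset.mem_singleton, not_or] at he
  exact ⟨e, he⟩

/-- Residual edges are the edges that lie in a triangle. -/
theorem isResEdge_iff_triangle (hn : 5 ≤ n) {u v : StarVertex n 3} :
    IsResEdge u v ↔ (starGraph n 3).Adj u v ∧
      ∃ w, (starGraph n 3).Adj u w ∧ (starGraph n 3).Adj w v := by
  constructor
  · intro h
    refine ⟨starGraph_adj_iff.2 (.inr (.inr h)), ?_⟩
    obtain ⟨e, h0, h1, h2, h3⟩ := exists_ne_of_five_le hn (u.1 0) (u.1 1) (u.1 2) (v.1 0)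
    rw [isResEdge_iff] at h
    refine ⟨triple e (u.1 1) (u.1 2) h1 h2 u.one_ne_two, ?_, ?_⟩ <;>
    · rw [starGraph_adj_iff]
      right; right
      rw [isResEdge_iff]
      simp
      grind
  · rintro ⟨huv, w, huw, hwv⟩
    have := u.zero_ne_one_s15
    have := u.zero_ne_two
    have := u.one_ne_two
    simp only [starGraph_adj_iff, isResEdge_iff, ext_iff_three, swapSnd, swapThd, triple_zero,
      triple_one, triple_two] at *
    grind

/-- The residual cliques of the two vertices are joined by a star edge. -/
def CliquesJoined (u v : StarVertex n 3) : Prop :=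
  ∃ p q : StarVertex n 3, (p = u ∨ IsResEdge p u) ∧ (q = v ∨ IsResEdge q v) ∧ IsStarEdge p q

theorem cliquesJoined_swapSnd {u v : StarVertex n 3} (h : IsResEdge u v) :
    CliquesJoined (swapSnd u) (swapSnd v) := by
  have := u.zero_ne_one_s15
  have := u.zero_ne_two
  have := v.zero_ne_one_s15
  have := v.zero_ne_two
  rw [isResEdge_iff] at h
  refine ⟨triple (v.1 0) (u.1 0) (u.1 2) h.1.symm (by grind) (by grind),
    triple (u.1 0) (v.1 0) (u.1 2) h.1 (by grind) (by grind), .inr ?_, .inr ?_, ?_⟩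
  · simp [isResEdge_iff, swapSnd]; grind
  · simp [isResEdge_iff, swapSnd]; grind
  · rw [isStarEdge_iff]
    left
    simp [swapSnd]

theorem not_cliquesJoined_swapSnd_swapThd {u v : StarVertex n 3} (h : IsResEdge u v) :
    ¬ CliquesJoined (swapSnd u) (swapThd v) := by
  rintro ⟨p, q, hp, hq, hpq⟩
  have := u.zero_ne_one_s15
  have := u.zero_ne_two
  have := v.zero_ne_one_s15
  have := v.zero_ne_two
  simp only [isStarEdge_iff, isResEdge_iff, ext_iff_three, swapSnd, swapThd, triple_zero,
      triple_one, triple_two] at *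
  grind

section Connectivity

variable {P : StarVertex n 3 → Prop} (hres : ∀ u v, IsResEdge u v → P u → P v)
  (hsnd : ∀ u, P u → P (swapSnd u))

include hres hsnd in
theorem induction_of_two_eq {u v : StarVertex n 3} (huv : u.1 2 = v.1 2) (hu : P u) : P v := by
  have hres' : ∀ u v : StarVertex n 3, u.1 1 = v.1 1 → u.1 2 = v.1 2 → P u → P v := by
    intro u v h1 h2 hu
    by_cases h0 : u.1 0 = v.1 0
    · rwa [← ext_iff_three.2 ⟨h0, h1, h2⟩]
    · exact hres u v (isResEdge_iff.2 ⟨h0, h1, h2⟩) hu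
  by_cases h1 : u.1 1 = v.1 1
  · exact hres' u v h1 huv hu
  · have hw := hsnd _ (hres' u (triple (v.1 1) (u.1 1) (u.1 2) (Ne.symm h1)
      (by rw [huv]; exact v.one_ne_two) u.one_ne_two) rfl rfl hu)
    exact hres' (swapSnd (triple _ _ _ _ _ _)) v rfl huv hw

include hres hsnd in
theorem induction_of_forall (hn : 5 ≤ n) (hthd : ∀ u, P u → P (swapThd u))
    {u : StarVertex n 3} (hu : P u) (v : StarVertex n 3) : P v := by
  by_cases h : u.1 2 = v.1 2
  · exact induction_of_two_eq hres hsnd h hu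
  · obtain ⟨e, he, he', -⟩ := exists_ne_of_five_le hn (u.1 2) (v.1 2) (v.1 2) (v.1 2)
    refine induction_of_two_eq hres hsnd (u := swapThd (triple (v.1 2) e (u.1 2) he'.symm
      (Ne.symm h) he)) rfl (hthd _ ?_)
    exact induction_of_two_eq hres hsnd (u := u) rfl hu

end Connectivity

end StarVertex

namespace StarVertex

variable {n : ℕ}

theorem isStarEdge_iff_adj {u v : StarVertex n 3} :
    IsStarEdge u v ↔ (starGraph n 3).Adj u v ∧ ¬ IsResEdge u v := by
  have := u.zero_ne_one_s15
  have := u.zero_ne_two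
  rw [starGraph_adj_iff, isStarEdge_iff]
  simp only [isResEdge_iff, ext_iff_three, swapSnd, swapThd, triple_zero, triple_one, triple_two]
  grind

/-- The exchange of the second and third entries, as a permutation of the vertices. -/
def twistPerm (n : ℕ) : Perm (StarVertex n 3) := ⟨twist, twist, twist_twist, twist_twist⟩

@[simp] theorem twistPerm_apply (u : StarVertex n 3) : twistPerm n u = twist u := rfl

theorem twistPerm_mul_self : twistPerm n * twistPerm n = 1 := Equiv.ext twist_twist

/-- The action of the symmetric group on the vertices. -/
def relabelHom (n : ℕ) : Perm (Fin n) →* Perm (StarVertex n 3) where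
  toFun σ := ⟨relabel σ, relabel σ⁻¹, fun u => by simp [relabel, ext_iff_three],
    fun u => by simp [ext_iff_three, relabel]⟩
  map_one' := Equiv.ext fun u => by simp [ext_iff_three, relabel]
  map_mul' σ τ := Equiv.ext fun u => by simp [relabel]

@[simp] theorem relabelHom_apply (σ : Perm (Fin n)) (u : StarVertex n 3) :
    relabelHom n σ u = relabel σ u := rfl

theorem relabelHom_mul_twistPerm (σ : Perm (Fin n)) :
    relabelHom n σ * twistPerm n = twistPerm n * relabelHom n σ := rfl

theorem relabelHom_mem_graphAut (σ : Perm (Fin n)) :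
    relabelHom n σ ∈ graphAut (starGraph n 3) := by
  intro u w
  simp [starGraph_adj_iff, isResEdge_iff, ext_iff_three, relabel, swapSnd, swapThd]

theorem twistPerm_mem_graphAut : twistPerm n ∈ graphAut (starGraph n 3) := by
  intro u w
  simp [starGraph_adj_iff, isResEdge_iff, ext_iff_three, twist, swapSnd, swapThd]
  grind

theorem exists_zero_one_eq (hn : 5 ≤ n) {x y : Fin n} (hxy : x ≠ y) :
    ∃ u : StarVertex n 3, u.1 0 = x ∧ u.1 1 = y := by
  obtain ⟨z, hx, hy, -⟩ := exists_ne_of_five_le hn x y y y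
  exact ⟨triple x y z hxy hx.symm hy.symm, rfl, rfl⟩

theorem exists_zero_eq (hn : 5 ≤ n) (x : Fin n) : ∃ u : StarVertex n 3, u.1 0 = x := by
  obtain ⟨y, hy, -⟩ := exists_ne_of_five_le hn x x x x
  obtain ⟨u, hu, -⟩ := exists_zero_one_eq hn hy.symm
  exact ⟨u, hu⟩

theorem relabelHom_injective (hn : 5 ≤ n) : Function.Injective (relabelHom n) := by
  intro σ τ h
  ext x
  obtain ⟨u, rfl⟩ := exists_zero_eq hn x
  have := congrArg (fun f : Perm (StarVertex n 3) => (f u).1 0) h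
  simpa [relabel] using congrArg Fin.val this

theorem twistPerm_mul_relabelHom_ne (hn : 5 ≤ n) (σ τ : Perm (Fin n)) :
    twistPerm n * relabelHom n σ ≠ relabelHom n τ := by
  intro h
  obtain ⟨u, hu⟩ := exists_zero_eq hn (⟨0, by omega⟩ : Fin n)
  have hσ : σ = τ := by
    ext x
    obtain ⟨v, rfl⟩ := exists_zero_eq hn x
    have := congrArg (fun f : Perm (StarVertex n 3) => (f v).1 0) h
    simpa [relabel, twist] using congrArg Fin.val this
  have := congrArg (fun f : Perm (StarVertex n 3) => (f u).1 1) h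
  simp only [Perm.mul_apply, relabelHom_apply, twistPerm_apply, relabel, twist, triple_one,
    triple_two, hσ] at this
  exact u.one_ne_two (τ.injective this).symm

section Automorphism

variable {φ : Perm (StarVertex n 3)} (hφ : φ ∈ graphAut (starGraph n 3))

include hφ

theorem isResEdge_map_iff (hn : 5 ≤ n) {u v : StarVertex n 3} :
    IsResEdge (φ u) (φ v) ↔ IsResEdge u v := by
  rw [isResEdge_iff_triangle hn, isResEdge_iff_triangle hn, hφ, ← φ.exists_congr_right]
  simp only [hφ _ _]

theorem isStarEdge_map_iff (hn : 5 ≤ n) {u v : StarVertex n 3} :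
    IsStarEdge (φ u) (φ v) ↔ IsStarEdge u v := by
  rw [isStarEdge_iff_adj, isStarEdge_iff_adj, hφ, isResEdge_map_iff hφ hn]

theorem CliquesJoined.map (hn : 5 ≤ n) {u v : StarVertex n 3} (h : CliquesJoined u v) :
    CliquesJoined (φ u) (φ v) := by
  obtain ⟨p, q, hp, hq, hpq⟩ := h
  refine ⟨φ p, φ q, ?_, ?_, (isStarEdge_map_iff hφ hn).2 hpq⟩
  · rwa [isResEdge_map_iff hφ hn, φ.apply_eq_iff_eq]
  · rwa [isResEdge_map_iff hφ hn, φ.apply_eq_iff_eq]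

theorem map_swapSnd (hn : 5 ≤ n) (u : StarVertex n 3) :
    φ (swapSnd u) = swapSnd (φ u) ∨ φ (swapSnd u) = swapThd (φ u) :=
  isStarEdge_iff.1 ((isStarEdge_map_iff hφ hn).2 (isStarEdge_iff.2 (.inl rfl)))

theorem map_swapThd (hn : 5 ≤ n) (u : StarVertex n 3) :
    φ (swapThd u) = swapSnd (φ u) ∨ φ (swapThd u) = swapThd (φ u) :=
  isStarEdge_iff.1 ((isStarEdge_map_iff hφ hn).2 (isStarEdge_iff.2 (.inr rfl)))

theorem map_swapThd_eq_iff (hn : 5 ≤ n) (u : StarVertex n 3) :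
    φ (swapThd u) = swapThd (φ u) ↔ φ (swapSnd u) = swapSnd (φ u) := by
  have h1 := map_swapSnd hφ hn u
  have h2 := map_swapThd hφ hn u
  have h3 := swapSnd_ne_swapThd (φ u)
  have h4 : φ (swapSnd u) ≠ φ (swapThd u) := φ.injective.ne (swapSnd_ne_swapThd u)
  grind

theorem map_swapSnd_eq_of_exists (hn : 5 ≤ n) {u : StarVertex n 3}
    (hu : φ (swapSnd u) = swapSnd (φ u)) (v : StarVertex n 3) :
    φ (swapSnd v) = swapSnd (φ v) := by
  refine induction_of_forall (P := fun v => φ (swapSnd v) = swapSnd (φ v)) ?_ ?_ hn ?_ hu v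
  · intro u v huv hu
    refine (map_swapSnd hφ hn v).resolve_right fun hv => ?_
    have := (cliquesJoined_swapSnd huv).map hφ hn
    rw [hu, hv] at this
    exact not_cliquesJoined_swapSnd_swapThd ((isResEdge_map_iff hφ hn).2 huv) this
  · intro u hu
    rw [swapSnd_swapSnd, hu, swapSnd_swapSnd]
  · intro u hu
    rw [← map_swapThd_eq_iff hφ hn] at hu ⊢
    rw [swapThd_swapThd, hu, swapThd_swapThd]

theorem exists_eq_relabelHom_of_map_swapSnd (hn : 5 ≤ n)
    (hsnd : ∀ v, φ (swapSnd v) = swapSnd (φ v)) : ∃ σ : Perm (Fin n), φ = relabelHom n σ := by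
  have hthd : ∀ v, φ (swapThd v) = swapThd (φ v) := fun v =>
    (map_swapThd_eq_iff hφ hn v).2 (hsnd v)
  have htwo : ∀ u v : StarVertex n 3, u.1 2 = v.1 2 → (φ u).1 2 = (φ v).1 2 := by
    intro u v huv
    refine induction_of_two_eq (P := fun w => (φ u).1 2 = (φ w).1 2) ?_ ?_ huv rfl
    · intro w w' h hw
      rw [hw, (isResEdge_iff.1 ((isResEdge_map_iff hφ hn).2 h)).2.2]
    · intro w hw
      rw [hsnd, hw]
      rfl
  have hzero : ∀ u v : StarVertex n 3, u.1 0 = v.1 0 → (φ u).1 0 = (φ v).1 0 := by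
    intro u v huv
    have := htwo (swapThd u) (swapThd v) huv
    rwa [hthd, hthd] at this
  choose r hr using exists_zero_eq hn
  have h0 : ∀ u : StarVertex n 3, (φ u).1 0 = (φ (r (u.1 0))).1 0 := fun u =>
    hzero _ _ (hr _).symm
  have h1 : ∀ u : StarVertex n 3, (φ u).1 1 = (φ (r (u.1 1))).1 0 := fun u => by
    have := h0 (swapSnd u)
    rwa [hsnd] at this
  have h2 : ∀ u : StarVertex n 3, (φ u).1 2 = (φ (r (u.1 2))).1 0 := fun u => by
    have := h0 (swapThd u)
    rwa [hthd] at this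
  have hinj : Function.Injective fun x => (φ (r x)).1 0 := by
    intro x y hxy
    by_contra hne
    obtain ⟨u, rfl, rfl⟩ := exists_zero_one_eq hn hne
    exact (φ u).zero_ne_one_s15 (by rw [h0, h1]; exact hxy)
  exact ⟨Equiv.ofBijective _ (Finite.injective_iff_bijective.1 hinj),
    Equiv.ext fun u => ext_iff_three.2 ⟨h0 u, h1 u, h2 u⟩⟩

/-- Every automorphism of `S_{n,3}` is a relabelling of the symbols, possibly followed by the
exchange of the last two positions. -/
theorem exists_relabelHom (hn : 5 ≤ n) :
    ∃ σ : Perm (Fin n), φ = relabelHom n σ ∨ φ = twistPerm n * relabelHom n σ := by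
  obtain ⟨u, -⟩ := exists_zero_eq hn (⟨0, by omega⟩ : Fin n)
  rcases map_swapSnd hφ hn u with h | h
  · obtain ⟨σ, hσ⟩ :=
      exists_eq_relabelHom_of_map_swapSnd hφ hn (map_swapSnd_eq_of_exists hφ hn h)
    exact ⟨σ, .inl hσ⟩
  · have hψ := mul_mem (twistPerm_mem_graphAut (n := n)) hφ
    have h' : (twistPerm n * φ) (swapSnd u) = swapSnd ((twistPerm n * φ) u) := by
      rw [Perm.mul_apply, h]
      rfl
    obtain ⟨σ, hσ⟩ :=
      exists_eq_relabelHom_of_map_swapSnd hψ hn (map_swapSnd_eq_of_exists hψ hn h')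
    refine ⟨σ, .inr ?_⟩
    rw [← hσ, ← mul_assoc, twistPerm_mul_self, one_mul]

end Automorphism

end StarVertex

/-! ### Regular groups of automorphisms -/

theorem isCayleyGraph_of_regular {V : Type} [Finite V] [Nonempty V] {Γ : SimpleGraph V}
    (P : Subgroup (Perm V)) (hP : P ≤ graphAut Γ) (hreg : ∀ u v, ∃! p : P, p.1 u = v) :
    IsCayleyGraph Γ := by
  obtain ⟨v₀⟩ := ‹Nonempty V›
  let f : P ≃ V := Equiv.ofBijective (fun p => p.1 v₀)
    ((Function.bijective_iff_existsUnique _).2 (hreg v₀))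
  have hadj : ∀ p q : P, Γ.Adj (p.1 v₀) (q.1 v₀) ↔ Γ.Adj v₀ ((p⁻¹ * q).1 v₀) := by
    intro p q
    rw [← hP p.2 v₀]
    simp
  refine ⟨P, inferInstance, Fintype.ofFinite P, {p | Γ.Adj v₀ (p.1 v₀)}, ?_, ?_,
    ⟨⟨f.symm, ?_⟩⟩⟩
  · simp
  · intro s hs
    simpa [Γ.adj_comm] using (hadj s 1).1 (by simpa using hs.symm)
  · intro u v
    obtain ⟨p, rfl⟩ := f.surjective u
    obtain ⟨q, rfl⟩ := f.surjective v
    simp only [Equiv.symm_apply_apply, SimpleGraph.fromRel_adj, Set.mem_ofPred_eq]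
    change _ ↔ Γ.Adj (p.1 v₀) (q.1 v₀)
    rw [← hadj p q, ← hadj q p, Γ.adj_comm (q.1 v₀), or_self, and_iff_right_iff_imp]
    rintro h rfl
    exact h.ne rfl

theorem IsCayleyGraph.exists_regular {V : Type*} {Γ : SimpleGraph V} (h : IsCayleyGraph Γ) :
    ∃ P : Subgroup (Perm V), P ≤ graphAut Γ ∧ ∀ u v, ∃! p : P, p.1 u = v := by
  obtain ⟨G, _, _, S, -, -, ⟨f⟩⟩ := h
  let Φ : G →* Perm V := f.toEquiv.symm.permCongrHom.toMonoidHom.comp (MulAction.toPermHom G G)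
  have hΦ : ∀ g v, Φ g v = f.symm (g * f v) := fun g v => rfl
  refine ⟨Φ.range, ?_, ?_⟩
  · rintro _ ⟨g, rfl⟩ u w
    rw [hΦ, hΦ, f.symm.map_adj_iff, ← f.map_adj_iff]
    simp [SimpleGraph.fromRel_adj, mul_assoc]
  · intro u v
    refine ⟨⟨Φ (f v * (f u)⁻¹), _, rfl⟩, ?_, ?_⟩
    · change f.symm (f v * (f u)⁻¹ * f u) = v
      simp
    · rintro ⟨_, g, rfl⟩ hg
      have hg' : f.symm (g * f u) = v := hg
      refine Subtype.ext (congrArg Φ ?_)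
      rw [← hg']
      simp

namespace StarVertex

variable {n : ℕ}

instance : Finite (StarVertex n 3) := Subtype.finite

/-- The permutations of the symbols that occur, up to the exchange of the last two positions,
in a group of permutations of the vertices. -/
def symbolGroup (P : Subgroup (Perm (StarVertex n 3))) : Subgroup (Perm (Fin n)) where
  carrier := {σ | relabelHom n σ ∈ P ∨ twistPerm n * relabelHom n σ ∈ P}
  one_mem' := .inl (by rw [map_one]; exact one_mem P)
  mul_mem' := by
    have hcomm : ∀ σ τ : Perm (Fin n), twistPerm n * relabelHom n (σ * τ) =
        relabelHom n σ * (twistPerm n * relabelHom n τ) := fun σ τ => by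
      rw [map_mul, ← mul_assoc, ← mul_assoc, relabelHom_mul_twistPerm]
    rintro σ τ (hσ | hσ) (hτ | hτ)
    · exact .inl (by rw [map_mul]; exact mul_mem hσ hτ)
    · exact .inr (by rw [hcomm]; exact mul_mem hσ hτ)
    · exact .inr (by rw [map_mul, ← mul_assoc]; exact mul_mem hσ hτ)
    · refine .inl ?_
      have := mul_mem hσ hτ
      rwa [mul_assoc, ← hcomm, ← mul_assoc, twistPerm_mul_self, one_mul] at this
  inv_mem' := by
    rintro σ (hσ | hσ)
    · exact .inl (by rw [map_inv]; exact inv_mem hσ)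
    · refine .inr ?_
      have := inv_mem hσ
      rwa [← relabelHom_mul_twistPerm, mul_inv_rev, ← map_inv,
        inv_eq_of_mul_eq_one_left twistPerm_mul_self] at this

section Regular

variable {P : Subgroup (Perm (StarVertex n 3))} (hP : P ≤ graphAut (starGraph n 3))
  (hreg : ∀ u v, ∃! p : P, p.1 u = v)

include hP hreg

theorem exists_mem_symbolGroup (hn : 5 ≤ n) (u v : StarVertex n 3) :
    ∃ σ ∈ symbolGroup P, relabel σ u = v ∨ relabel σ u = twist v := by
  obtain ⟨⟨p, hp⟩, hpv, -⟩ := hreg u v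
  obtain ⟨σ, rfl | rfl⟩ := exists_relabelHom (hP hp) hn
  · exact ⟨σ, .inl hp, .inl hpv⟩
  · refine ⟨σ, .inr hp, .inr ?_⟩
    rw [← hpv]
    exact (twist_twist _).symm

theorem exists_swap_mem_symbolGroup (hn : 5 ≤ n) (ht : twistPerm n ∉ P) :
    ∃ w : StarVertex n 3, ∃ σ ∈ symbolGroup P, relabel σ w = twist w := by
  obtain ⟨u, -⟩ := exists_zero_eq hn (⟨0, by omega⟩ : Fin n)
  obtain ⟨⟨p, hp⟩, hpu, -⟩ := hreg u (twist u)
  obtain ⟨σ, rfl | rfl⟩ := exists_relabelHom (hP hp) hn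
  · exact ⟨u, σ, .inl hp, hpu⟩
  have hσu : relabel σ u = u := by
    have := congrArg twist hpu
    rwa [twist_twist, Perm.mul_apply, twistPerm_apply, twist_twist] at this
  have hsq : relabelHom n (σ * σ) = 1 := by
    have hmem : relabelHom n (σ * σ) ∈ P := by
      have heq : relabelHom n (σ * σ) =
          twistPerm n * relabelHom n σ * (twistPerm n * relabelHom n σ) :=
        Equiv.ext fun _ => ext_iff_three.2 ⟨rfl, rfl, rfl⟩
      rw [heq]
      exact mul_mem hp hp
    exact congrArg Subtype.val ((hreg u u).unique (y₁ := ⟨_, hmem⟩) (y₂ := 1)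
      (by simp [hσu]) rfl)
  have hsq' : σ * σ = 1 := relabelHom_injective hn (by rw [hsq, map_one])
  obtain ⟨b, hb⟩ : ∃ b, σ b ≠ b := by
    by_contra! h
    have : σ = 1 := Equiv.ext h
    rw [this, map_one, mul_one] at hp
    exact ht hp
  have hσ0 : σ (u.1 0) = u.1 0 := (ext_iff_three.1 hσu).1
  have hσb : σ (σ b) = b := by rw [← Perm.mul_apply, hsq', Perm.one_apply]
  have hb0 : u.1 0 ≠ b := by rintro rfl; exact hb hσ0
  have hb1 : u.1 0 ≠ σ b := fun h => hb0 (σ.injective (hσ0.trans h))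
  exact ⟨triple (u.1 0) b (σ b) hb0 hb1 hb.symm, σ, .inr hp,
    ext_iff_three.2 ⟨hσ0, rfl, hσb⟩⟩

omit hP in
theorem card_symbolGroup_le (hn : 5 ≤ n) :
    Nat.card (symbolGroup P) ≤ Nat.card (StarVertex n 3) := by
  classical
  obtain ⟨u, -⟩ := exists_zero_eq hn (⟨0, by omega⟩ : Fin n)
  rw [← Nat.card_congr (Equiv.ofBijective (fun p : P => p.1 u)
    ((Function.bijective_iff_existsUnique _).2 (hreg u)))]
  have hex : ∀ σ : symbolGroup P, ∃ p : P,
      p.1 = relabelHom n σ.1 ∨ p.1 = twistPerm n * relabelHom n σ.1 := by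
    rintro ⟨σ, h | h⟩
    · exact ⟨⟨_, h⟩, .inl rfl⟩
    · exact ⟨⟨_, h⟩, .inr rfl⟩
  choose f hf using hex
  refine Nat.card_le_card_of_injective f fun σ τ h => Subtype.ext ?_
  have h1 := hf σ
  have h2 := hf τ
  rw [h] at h1
  rcases h1 with h1 | h1 <;> rcases h2 with h2 | h2
  · exact relabelHom_injective hn (h1.symm.trans h2)
  · exact absurd (h2.symm.trans h1) (twistPerm_mul_relabelHom_ne hn _ _)
  · exact absurd (h1.symm.trans h2) (twistPerm_mul_relabelHom_ne hn _ _)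
  · exact relabelHom_injective hn (mul_left_cancel (h1.symm.trans h2))

theorem eq_one_of_relabel_eq (hn : 5 ≤ n) {σ : Perm (Fin n)} (hσ : σ ∈ symbolGroup P)
    {u : StarVertex n 3} (hu : relabel σ u = u) : σ = 1 := by
  by_cases ht : twistPerm n ∈ P
  · have hmem : relabelHom n σ ∈ P := by
      rcases hσ with hσ | hσ
      · exact hσ
      · have := mul_mem ht hσ
        rwa [← mul_assoc, twistPerm_mul_self, one_mul] at this
    refine relabelHom_injective hn ?_
    rw [map_one]
    exact congrArg Subtype.val ((hreg u u).unique (y₁ := ⟨_, hmem⟩) (y₂ := 1) hu rfl)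
  · obtain ⟨w, s, hs, hsw⟩ := exists_swap_mem_symbolGroup hP hreg hn ht
    have hmul : ∀ (σ τ : Perm (Fin n)) v, relabel (σ * τ) v = relabel σ (relabel τ v) :=
      fun _ _ _ => rfl
    have hsurj : Function.Surjective fun σ : symbolGroup P => relabel σ.1 w := by
      intro v
      obtain ⟨τ, hτ, h | h⟩ := exists_mem_symbolGroup hP hreg hn w v
      · exact ⟨⟨τ, hτ⟩, h⟩
      · refine ⟨⟨τ * s, mul_mem hτ hs⟩, ?_⟩
        change relabel (τ * s) w = v
        rw [hmul, hsw]
        exact (congrArg twist h).trans (twist_twist v)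
    have hinj := (hsurj.bijective_of_nat_card_le (card_symbolGroup_le hreg hn)).injective
    obtain ⟨⟨τ, hτ⟩, rfl⟩ := hsurj u
    have := hinj (a₁ := ⟨σ * τ, mul_mem hσ hτ⟩) (a₂ := ⟨τ, hτ⟩) hu
    exact mul_eq_right.1 (congrArg Subtype.val this)

theorem isPrimePow_of_regular (hn : 5 ≤ n) : IsPrimePow (n - 1) := by
  let x₀ : Fin n := ⟨0, by omega⟩
  have hcard : Nat.card (SubMulAction.ofStabilizer (symbolGroup P) x₀) = n - 1 := by
    rw [SubMulAction.nat_card_ofStabilizer_eq, Nat.card_eq_fintype_card, Fintype.card_fin]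
  have hne : ∀ a : SubMulAction.ofStabilizer (symbolGroup P) x₀, x₀ ≠ a.1 := fun a =>
    (SubMulAction.mem_ofStabilizer_iff _ _).1 a.2 |>.symm
  rw [← hcard]
  refine isPrimePow_card_of_twoHomogeneous
    (L := MulAction.stabilizer (symbolGroup P) x₀) (by omega) ?_ ?_
  · rintro ⟨⟨σ, hσ⟩, hσ0⟩ a b hab ha hb
    have : σ = 1 := eq_one_of_relabel_eq hP hreg hn hσ
      (u := triple x₀ a b (hne a) (hne b) (fun h => hab (Subtype.ext h)))
      (ext_iff_three.2 ⟨hσ0, congrArg Subtype.val ha, congrArg Subtype.val hb⟩)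
    subst this
    rfl
  · intro a b c d hab hcd
    obtain ⟨σ, hσ, h | h⟩ := exists_mem_symbolGroup hP hreg hn
      (triple x₀ a b (hne a) (hne b) (fun h => hab (Subtype.ext h)))
      (triple x₀ c d (hne c) (hne d) (fun h => hcd (Subtype.ext h)))
    all_goals
      obtain ⟨h0, h1, h2⟩ := ext_iff_three.1 h
      refine ⟨⟨⟨σ, hσ⟩, h0⟩, ?_⟩
    · exact .inl ⟨Subtype.ext h1, Subtype.ext h2⟩
    · exact .inr ⟨Subtype.ext h1, Subtype.ext h2⟩

end Regular

theorem isCayleyGraph_of_isSharplyMultTrans (hn : 5 ≤ n) {H : Subgroup (Perm (Fin n))}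
    (hH : IsSharplyMultTrans n 3 H) : IsCayleyGraph (starGraph n 3) := by
  obtain ⟨u, -⟩ := exists_zero_eq hn (⟨0, by omega⟩ : Fin n)
  have : Nonempty (StarVertex n 3) := ⟨u⟩
  refine isCayleyGraph_of_regular (H.map (relabelHom n)) ?_ ?_
  · rintro _ ⟨σ, -, rfl⟩
    exact relabelHom_mem_graphAut σ
  · intro u v
    obtain ⟨⟨σ, hσ⟩, hσv, huniq⟩ := hH u.1 v.1 u.2 v.2
    refine ⟨⟨_, σ, hσ, rfl⟩, ext_iff_three.2 ⟨hσv 0, hσv 1, hσv 2⟩, ?_⟩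
    rintro ⟨_, τ, hτ, rfl⟩ hτv
    obtain ⟨h0, h1, h2⟩ := ext_iff_three.1 hτv
    have := huniq ⟨τ, hτ⟩ (by intro j; fin_cases j <;> assumption)
    exact Subtype.ext (congrArg (relabelHom n) (congrArg Subtype.val this))

end StarVertex

/-! ### The projective line over a finite field -/

section ProjectiveLine

open OnePoint Matrix.GeneralLinearGroup

variable {K : Type*} [Field K] [DecidableEq K]

theorem exists_smul_eq_zero_one_infty {a b c : OnePoint K} (hab : a ≠ b) (hac : a ≠ c)
    (hbc : b ≠ c) : ∃ g : GL (Fin 2) K,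
      g • a = ∞ ∧ g • b = ((0 : K) : OnePoint K) ∧ g • c = ((1 : K) : OnePoint K) := by
  obtain ⟨g, hg⟩ : ∃ g : GL (Fin 2) K, g • a = ∞ := by
    cases a with
    | infty => exact ⟨1, one_smul _ _⟩
    | coe a =>
      refine ⟨mkOfDetNeZero !![0, 1; 1, -a] (by simp [Matrix.det_fin_two]), ?_⟩
      simp [smul_some_eq_ite, mkOfDetNeZero]
  have hb : g • b ≠ ∞ := fun h => hab (MulAction.injective g (hg.trans h.symm))
  have hc : g • c ≠ ∞ := fun h => hac (MulAction.injective g (hg.trans h.symm))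
  obtain ⟨x, hx⟩ := ne_infty_iff_exists.1 hb
  obtain ⟨y, hy⟩ := ne_infty_iff_exists.1 hc
  have hxy : y - x ≠ 0 := sub_ne_zero.2 fun h =>
    hbc (MulAction.injective g (by change g • b = g • c; rw [← hx, ← hy, h]))
  refine ⟨mkOfDetNeZero !![1, -x; 0, y - x] (by simpa [Matrix.det_fin_two]) * g, ?_, ?_, ?_⟩
  · rw [mul_smul, hg]
    simp [smul_infty_eq_ite, mkOfDetNeZero]
  · rw [mul_smul, ← hx]
    simp [smul_some_eq_ite, mkOfDetNeZero, hxy]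
  · rw [mul_smul, ← hy]
    simp [smul_some_eq_ite, mkOfDetNeZero, hxy, ← sub_eq_add_neg]

theorem smul_eq_self_of_fixes_zero_one_infty {g : GL (Fin 2) K}
    (hinf : g • (∞ : OnePoint K) = ∞) (hzero : g • ((0 : K) : OnePoint K) = ((0 : K) : OnePoint K))
    (hone : g • ((1 : K) : OnePoint K) = ((1 : K) : OnePoint K)) (x : OnePoint K) : g • x = x := by
  have h10 := smul_infty_eq_self_iff.1 hinf
  have hdet := g.det_ne_zero
  rw [Matrix.det_fin_two, h10, mul_zero, sub_zero] at hdet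
  have h11 := right_ne_zero_of_mul hdet
  rw [smul_some_eq_ite] at hzero hone
  simp only [h10, h11, zero_add, mul_zero, mul_one, if_false, coe_eq_coe,
    div_eq_zero_iff, or_false] at hzero hone
  rw [hzero, add_zero, div_eq_one_iff_eq h11] at hone
  cases x with
  | infty => exact hinf
  | coe x => rw [smul_some_eq_ite, h10, hzero, hone]; simp [h11]

theorem existsUnique_toPermHom_range {a b : Fin 3 → OnePoint K}
    (ha : Function.Injective a) (hb : Function.Injective b) :
    ∃! μ : (MulAction.toPermHom (GL (Fin 2) K) (OnePoint K)).range, ∀ j, μ.1 (a j) = b j := by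
  have key : ∀ c : Fin 3 → OnePoint K, Function.Injective c → ∃ g : GL (Fin 2) K,
      g • c 0 = ∞ ∧ g • c 1 = ((0 : K) : OnePoint K) ∧ g • c 2 = ((1 : K) : OnePoint K) :=
    fun c hc => exists_smul_eq_zero_one_infty (hc.ne (by decide)) (hc.ne (by decide))
      (hc.ne (by decide))
  obtain ⟨g, hg0, hg1, hg2⟩ := key a ha
  obtain ⟨h, hh0, hh1, hh2⟩ := key b hb
  refine ⟨⟨_, h⁻¹ * g, rfl⟩, ?_, ?_⟩
  · intro j
    change (h⁻¹ * g) • a j = b j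
    rw [mul_smul, inv_smul_eq_iff]
    fin_cases j
    exacts [hg0.trans hh0.symm, hg1.trans hh1.symm, hg2.trans hh2.symm]
  · rintro ⟨_, k, rfl⟩ hk
    have hk' : ∀ j, k • a j = b j := hk
    refine Subtype.ext (Equiv.ext fun x => ?_)
    change k • x = (h⁻¹ * g) • x
    have hfix := smul_eq_self_of_fixes_zero_one_infty (g := h * k * g⁻¹)
      (by rw [mul_smul, mul_smul, inv_smul_eq_iff.2 hg0.symm, hk', hh0])
      (by rw [mul_smul, mul_smul, inv_smul_eq_iff.2 hg1.symm, hk', hh1])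
      (by rw [mul_smul, mul_smul, inv_smul_eq_iff.2 hg2.symm, hk', hh2]) (g • x)
    rw [mul_smul, mul_smul, inv_smul_smul] at hfix
    rw [mul_smul, eq_inv_smul_iff, hfix]

end ProjectiveLine

theorem exists_isSharplyMultTrans_three {n : ℕ} (h : IsPrimePow (n - 1)) :
    ∃ H : Subgroup (Perm (Fin n)), IsSharplyMultTrans n 3 H := by
  classical
  obtain ⟨p, k, hp, hk, hpk⟩ := (isPrimePow_nat_iff _).1 h
  have : Fact p.Prime := ⟨hp⟩
  let K := GaloisField p k
  have hcard : Nat.card (OnePoint K) = n := by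
    have h1 : Nat.card K = n - 1 := by rw [GaloisField.card p k hk.ne', hpk]
    have h2 := h.one_lt
    have h3 : Nat.card (OnePoint K) = Nat.card K + 1 := Finite.card_option
    omega
  have : Finite (OnePoint K) := inferInstanceAs (Finite (Option K))
  let e : OnePoint K ≃ Fin n := Finite.equivFinOfCardEq hcard
  refine ⟨(MulAction.toPermHom (GL (Fin 2) K) (OnePoint K)).range.map
    e.permCongrHom.toMonoidHom, fun a b ha hb => ?_⟩
  obtain ⟨⟨μ, hμ⟩, hab, huniq⟩ := existsUnique_toPermHom_range
    (e.symm.injective.comp ha) (e.symm.injective.comp hb)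
  have hconj : ∀ (ν : Perm (OnePoint K)) j, e.permCongrHom ν (a j) = b j ↔
      ν (e.symm (a j)) = e.symm (b j) := fun ν j => by
    rw [Equiv.eq_symm_apply]
    rfl
  refine ⟨⟨_, μ, hμ, rfl⟩, fun j => (hconj _ _).2 (hab j), ?_⟩
  rintro ⟨_, ν, hν, rfl⟩ hν'
  have := huniq ⟨ν, hν⟩ fun j => (hconj ν j).1 (hν' j)
  exact Subtype.ext (congrArg e.permCongrHom (congrArg Subtype.val this))

/-- For every `n ≥ 5`, the `(n,3)`-star graph `S_{n,3}` is a Cayley graph if and only if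
`n - 1` is a prime power. -/
theorem star_graph_three_cayley_iff (n : ℕ) (hn : 5 ≤ n) :
    IsCayleyGraph (starGraph n 3) ↔ IsPrimePow (n - 1) := by
  constructor
  · intro h
    obtain ⟨P, hP, hreg⟩ := h.exists_regular
    exact StarVertex.isPrimePow_of_regular hP hreg hn
  · intro h
    obtain ⟨H, hH⟩ := exists_isSharplyMultTrans_three h
    exact StarVertex.isCayleyGraph_of_isSharplyMultTrans hn hH
end

section
/- The projective special linear group PSL(2,8), in its natural action on the projective line P¹(F_8) over the field with 8 elements (a set of 9 points), is sharply (5,3,1)-transitive: it acts regularly on the set of ordered triples (P_1, P_2, P_3) of pairwise disjoint subsets of P¹(F_8) with |P_1| = 5, |P_2| = 3, |P_3| = 1. -/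
open Equiv

open scoped LinearAlgebra.Projectivization in
/-- The action of `SL(2, F₈)` on the projective line `ℙ¹(F₈)` induced by matrix
multiplication on homogeneous coordinates. -/
noncomputable def projAct (A : Matrix.SpecialLinearGroup (Fin 2) (GaloisField 2 3)) :
    ℙ (GaloisField 2 3) (Fin 2 → GaloisField 2 3) →
      ℙ (GaloisField 2 3) (Fin 2 → GaloisField 2 3) :=
  Projectivization.map (Matrix.SpecialLinearGroup.toLin' A).toLinearMap
    (Matrix.SpecialLinearGroup.toLin' A).injective

section AffineMaps

variable {F : Type*} [Field F] [Fintype F] [DecidableEq F]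

/-- In a field with eight elements, a nonconstant affine map stabilizing a three-element set is
the identity. -/
lemma affine_eq_id_of_image_eq [CharP F 2] (hF : Fintype.card F = 8) {S : Finset F}
    (hS : S.card = 3) {c d : F} (hc : c ≠ 0) (h : S.image (fun u => c * u + d) = S) :
    c = 1 ∧ d = 0 := by
  have hinj : Function.Injective fun u : F => c * u + d := fun u v huv => by
    simpa [hc] using huv
  have h2 : (2 : F) = 0 := CharTwo.two_eq_zero
  have hsum : ∑ u ∈ S, (c * u + d) = ∑ u ∈ S, u := by
    conv_rhs => rw [← h, Finset.sum_image hinj.injOn]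
  have hprod (e : F) : ∏ u ∈ S, (c * u + d - e) = ∏ u ∈ S, (u - e) := by
    conv_rhs => rw [← h, Finset.prod_image hinj.injOn]
  obtain ⟨x, y, z, hxy, hxz, hyz, rfl⟩ := Finset.card_eq_three.mp hS
  have hsum' : c * (x + y + z) + d = x + y + z := by
    rw [Finset.sum_insert (by simp [hxy, hxz]), Finset.sum_pair hyz,
      Finset.sum_insert (by simp [hxy, hxz]), Finset.sum_pair hyz] at hsum
    linear_combination hsum - d * h2
  have hp := hprod (x + y + z)
  rw [Finset.prod_insert (by simp [hxy, hxz]), Finset.prod_pair hyz,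
    Finset.prod_insert (by simp [hxy, hxz]), Finset.prod_pair hyz] at hp
  have hxy' : x + y ≠ 0 := fun h0 => hxy (CharTwo.add_eq_zero.mp h0)
  have hxz' : x + z ≠ 0 := fun h0 => hxz (CharTwo.add_eq_zero.mp h0)
  have hyz' : y + z ≠ 0 := fun h0 => hyz (CharTwo.add_eq_zero.mp h0)
  have hd : d = x + y + z - c * (x + y + z) := by linear_combination hsum'
  have hc3 : c ^ 3 = 1 := by
    apply mul_right_cancel₀ (mul_ne_zero (mul_ne_zero hxy' hxz') hyz')
    subst hd
    linear_combination -hp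
  have hc7 : c ^ 7 = 1 := by
    have := FiniteField.pow_card_sub_one_eq_one c hc
    rwa [hF] at this
  have hc1 : c = 1 := by linear_combination hc7 - (c ^ 4 + c) * hc3
  subst hc1
  exact ⟨rfl, by linear_combination hsum'⟩

/-- In a field with eight elements, the affine group is transitive on three-element sets. -/
lemma exists_affine_image_eq [CharP F 2] (hF : Fintype.card F = 8) {S T : Finset F}
    (hS : S.card = 3) (hT : T.card = 3) :
    ∃ a b : F, a ≠ 0 ∧ S.image (fun u => a * u + b) = T := by
  have hinj (a : Fˣ) (b : F) : Function.Injective fun u : F => a * u + b := fun u v huv => by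
    simpa using huv
  let f : Fˣ × F → Finset.powersetCard 3 (Finset.univ : Finset F) := fun q =>
    ⟨S.image fun u => q.1 * u + q.2, by
      simp [Finset.mem_powersetCard, Finset.card_image_of_injective _ (hinj q.1 q.2), hS]⟩
  have hf : Function.Injective f := by
    rintro ⟨a, b⟩ ⟨a', b'⟩ h
    have h' : S.image (fun u => (a : F) * u + b) = S.image (fun u => (a' : F) * u + b') :=
      congrArg Subtype.val h
    have key : S.image (fun u => ((a'⁻¹ * a : Fˣ) : F) * u + (a'⁻¹ : Fˣ) * (b - b')) = S := by
      apply Finset.image_injective (hinj a' b')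
      rw [Finset.image_image, ← h']
      congr 1
      ext u
      have := a'.mul_inv
      simp only [Function.comp_apply, Units.val_mul]
      linear_combination (a * u + b - b') * this
    obtain ⟨h1, h0⟩ := affine_eq_id_of_image_eq hF hS (Units.ne_zero _) key
    have ha : a = a' := (inv_mul_eq_one.mp (Units.ext h1)).symm
    have hb : b = b' := sub_eq_zero.mp ((mul_eq_zero.mp h0).resolve_left (Units.ne_zero _))
    rw [ha, hb]
  have hcard : Fintype.card (Fˣ × F) =
      Fintype.card (Finset.powersetCard 3 (Finset.univ : Finset F)) := by
    rw [Fintype.card_prod, Fintype.card_units, Fintype.card_coe, Finset.card_powersetCard,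
      Finset.card_univ, hF]
    decide
  obtain ⟨⟨a, b⟩, hab⟩ := ((Fintype.bijective_iff_injective_and_card f).mpr ⟨hf, hcard⟩).2
    ⟨T, by simp [Finset.mem_powersetCard, hT]⟩
  exact ⟨a, b, a.ne_zero, congrArg Subtype.val hab⟩

end AffineMaps

section ProjectiveLine

open scoped LinearAlgebra.Projectivization

local notation "F₈" => GaloisField 2 3
local notation "SL₂" => Matrix.SpecialLinearGroup (Fin 2) (GaloisField 2 3)

/-- The point at infinity `[1 : 0]` of the projective line. -/
noncomputable def infPt : ℙ F₈ (Fin 2 → F₈) :=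
  Projectivization.mk F₈ ![1, 0] (by simp)

/-- The affine point `[u : 1]` of the projective line. -/
noncomputable def affPt (u : F₈) : ℙ F₈ (Fin 2 → F₈) :=
  Projectivization.mk F₈ ![u, 1] (by simp)

lemma card_F8 [Fintype F₈] : Fintype.card F₈ = 8 := by
  rw [← Nat.card_eq_fintype_card, GaloisField.card 2 3 (by norm_num)]
  norm_num

lemma mulVec_ne_zero (A : SL₂) {v : Fin 2 → F₈} (hv : v ≠ 0) : A.1.mulVec v ≠ 0 := fun h =>
  hv ((Matrix.SpecialLinearGroup.toLin' A).injective (h.trans (map_zero _).symm))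

lemma projAct_mk (A : SL₂) (v : Fin 2 → F₈) (hv : v ≠ 0) :
    projAct A (Projectivization.mk F₈ v hv) =
      Projectivization.mk F₈ (A.1.mulVec v) (mulVec_ne_zero A hv) := rfl

lemma projAct_mul (A B : SL₂) (q : ℙ F₈ (Fin 2 → F₈)) :
    projAct (A * B) q = projAct A (projAct B q) := by
  induction q using Projectivization.ind with
  | h v hv => simp only [projAct_mk, Matrix.SpecialLinearGroup.coe_mul, Matrix.mulVec_mulVec]

lemma projAct_one (q : ℙ F₈ (Fin 2 → F₈)) : projAct 1 q = q := by
  induction q using Projectivization.ind with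
  | h v hv => simp [projAct_mk]

lemma projAct_inv_projAct (A : SL₂) (q : ℙ F₈ (Fin 2 → F₈)) :
    projAct A⁻¹ (projAct A q) = q := by
  rw [← projAct_mul, inv_mul_cancel, projAct_one]

lemma projAct_bijective (A : SL₂) : Function.Bijective (projAct A) :=
  Function.bijective_iff_has_inverse.mpr ⟨projAct A⁻¹, projAct_inv_projAct A, fun q => by
    simpa using projAct_inv_projAct A⁻¹ q⟩

lemma exists_entries_eq {a b c d : F₈} (h : a * d - b * c = 1) :
    ∃ A : SL₂, A.1 0 0 = a ∧ A.1 0 1 = b ∧ A.1 1 0 = c ∧ A.1 1 1 = d :=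
  ⟨⟨!![a, b; c, d], (Matrix.det_fin_two_of a b c d).trans h⟩, rfl, rfl, rfl, rfl⟩

lemma exists_projAct_infPt (q : ℙ F₈ (Fin 2 → F₈)) : ∃ A : SL₂, projAct A infPt = q := by
  induction q using Projectivization.ind with
  | h v hv =>
    obtain ⟨b, d, hbd⟩ : ∃ b d : F₈, v 0 * d - b * v 1 = 1 := by
      by_cases h0 : v 0 = 0
      · have h1 : v 1 ≠ 0 := fun h1 => hv (by ext i; fin_cases i <;> simp [h0, h1])
        exact ⟨-(v 1)⁻¹, 0, by simp [h1]⟩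
      · exact ⟨0, (v 0)⁻¹, by simp [h0]⟩
    obtain ⟨A, h00, -, h10, -⟩ := exists_entries_eq hbd
    refine ⟨A, ?_⟩
    rw [infPt, projAct_mk]
    congr 1
    ext i
    fin_cases i <;> simp [Matrix.mulVec, dotProduct, h00, h10]

lemma exists_affPt_eq {q : ℙ F₈ (Fin 2 → F₈)} (hq : q ≠ infPt) : ∃ u, affPt u = q := by
  induction q using Projectivization.ind with
  | h v hv =>
    have h1 : v 1 ≠ 0 := by
      refine fun h1 => hq ?_
      rw [infPt, Projectivization.mk_eq_mk_iff']
      exact ⟨v 0, by ext i; fin_cases i <;> simp [h1]⟩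
    refine ⟨v 0 / v 1, ?_⟩
    rw [affPt, Projectivization.mk_eq_mk_iff']
    exact ⟨(v 1)⁻¹, by ext i; fin_cases i <;> simp [h1, div_eq_inv_mul]⟩

lemma affPt_injective : Function.Injective affPt := by
  intro u w h
  rw [affPt, affPt, Projectivization.mk_eq_mk_iff'] at h
  obtain ⟨a, ha⟩ := h
  have h0 := congrFun ha 0
  have h1 := congrFun ha 1
  simp at h0 h1
  simpa [h1] using h0.symm

/-- Elements of `SL(2, F₈)` fixing the point at infinity act on affine points by affine maps. -/
lemma projAct_affPt {A : SL₂} (hA : A.1 1 0 = 0) (u : F₈) :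
    projAct A (affPt u) = affPt (A.1 0 0 ^ 2 * u + A.1 0 0 * A.1 0 1) := by
  have hdet := A.2
  rw [Matrix.det_fin_two, hA, mul_zero, sub_zero] at hdet
  rw [affPt, projAct_mk, affPt, Projectivization.mk_eq_mk_iff']
  refine ⟨A.1 1 1, ?_⟩
  ext i
  fin_cases i
  · simp [Matrix.mulVec, dotProduct, Fin.sum_univ_two]
    linear_combination (A.1 0 0 * u + A.1 0 1) * hdet
  · simp [Matrix.mulVec, dotProduct, Fin.sum_univ_two, hA]

lemma projAct_infPt_eq_iff (A : SL₂) : projAct A infPt = infPt ↔ A.1 1 0 = 0 := by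
  rw [infPt, projAct_mk, Projectivization.mk_eq_mk_iff']
  constructor
  · rintro ⟨a, ha⟩
    simpa [Matrix.mulVec, dotProduct, Fin.sum_univ_two] using (congrFun ha 1).symm
  · intro h
    exact ⟨A.1 0 0, by ext i; fin_cases i <;> simp [Matrix.mulVec, dotProduct, Fin.sum_univ_two, h]⟩

/-- Every affine map is induced by an element of `SL(2, F₈)`, since every element of `F₈` is a
square. -/
lemma exists_projAct_eq_affine {a : F₈} (ha : a ≠ 0) (b : F₈) :
    ∃ A : SL₂, projAct A infPt = infPt ∧ ∀ u, projAct A (affPt u) = affPt (a * u + b) := by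
  obtain ⟨s, rfl⟩ := (FiniteField.isSquare_of_char_two (ringChar.eq F₈ 2) a)
  have hs : s ≠ 0 := left_ne_zero_of_mul ha
  obtain ⟨A, h00, h01, h10, -⟩ := exists_entries_eq (a := s) (b := b * s⁻¹) (c := 0) (d := s⁻¹)
    (by simp [hs])
  refine ⟨A, (projAct_infPt_eq_iff A).mpr h10, fun u => ?_⟩
  rw [projAct_affPt h10, h00, h01]
  congr 1
  field_simp

/-- A pair of disjoint sets of sizes `3` and `1` can be moved to a set of affine points and the
point at infinity. -/
lemma exists_normal_form {P₂ P₃ : Set (ℙ F₈ (Fin 2 → F₈))} (h : Disjoint P₂ P₃)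
    (h₂ : P₂.ncard = 3) (h₃ : P₃.ncard = 1) :
    ∃ (A : SL₂) (S : Finset F₈), S.card = 3 ∧ projAct A '' {infPt} = P₃ ∧
      projAct A '' (affPt '' S) = P₂ := by
  obtain ⟨p, rfl⟩ := Set.ncard_eq_one.mp h₃
  obtain ⟨A, rfl⟩ := exists_projAct_infPt p
  have hinj := (projAct_bijective A).1.comp affPt_injective
  have hrange : P₂ ⊆ Set.range (projAct A ∘ affPt) := by
    intro q hq
    obtain ⟨r, rfl⟩ := (projAct_bijective A).2 q
    obtain ⟨u, rfl⟩ := exists_affPt_eq (q := r) (by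
      rintro rfl
      exact Set.disjoint_left.mp h hq rfl)
    exact ⟨u, rfl⟩
  refine ⟨A, (Set.toFinite ((projAct A ∘ affPt) ⁻¹' P₂)).toFinset, ?_, by simp, ?_⟩
  · rw [← Set.ncard_eq_toFinset_card, Set.ncard_preimage_of_injective_subset_range hinj hrange, h₂]
  · rw [Set.Finite.coe_toFinset, ← Set.image_comp, Set.image_preimage_eq_of_subset hrange]

lemma eq_compl_of_ncard {P₁ P₂ P₃ : Set (ℙ F₈ (Fin 2 → F₈))} (h₁₂ : Disjoint P₁ P₂)
    (h₁₃ : Disjoint P₁ P₃) (h₂₃ : Disjoint P₂ P₃) (h₁ : P₁.ncard = 5) (h₂ : P₂.ncard = 3)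
    (h₃ : P₃.ncard = 1) : P₁ = (P₂ ∪ P₃)ᶜ := by
  have hcard : Nat.card (ℙ F₈ (Fin 2 → F₈)) = 9 := by
    rw [Projectivization.card_of_finrank_two F₈ _ (by simp), GaloisField.card 2 3 (by norm_num)]
    norm_num
  have : Finite (ℙ F₈ (Fin 2 → F₈)) := Nat.finite_of_card_ne_zero (by omega)
  refine Set.eq_of_subset_of_ncard_le
    (Set.subset_compl_iff_disjoint_right.mpr (h₁₂.union_right h₁₃)) ?_
  have := Set.ncard_add_ncard_compl (P₂ ∪ P₃)
  rw [Set.ncard_union_eq h₂₃] at this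
  omega

end ProjectiveLine

open scoped LinearAlgebra.Projectivization in
/-- `PSL(2,8) = SL(2,F₈)/Z(SL(2,F₈))` acts sharply `(5,3,1)`-transitively on the projective
line `ℙ¹(F₈)` (a set of `9` points): the action on ordered triples `(P₁,P₂,P₃)` of pairwise
disjoint subsets with `|P₁| = 5`, `|P₂| = 3`, `|P₃| = 1` is transitive, and any element of
`SL(2,F₈)` fixing such a triple lies in the center (i.e. is trivial in `PSL(2,8)`). -/
theorem psl_2_8_sharply_531_transitive :
    (∀ P₁ P₂ P₃ Q₁ Q₂ Q₃ : Set (ℙ (GaloisField 2 3) (Fin 2 → GaloisField 2 3)),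
      Disjoint P₁ P₂ → Disjoint P₁ P₃ → Disjoint P₂ P₃ →
      Disjoint Q₁ Q₂ → Disjoint Q₁ Q₃ → Disjoint Q₂ Q₃ →
      P₁.ncard = 5 → P₂.ncard = 3 → P₃.ncard = 1 →
      Q₁.ncard = 5 → Q₂.ncard = 3 → Q₃.ncard = 1 →
      ∃ A : Matrix.SpecialLinearGroup (Fin 2) (GaloisField 2 3),
        projAct A '' P₁ = Q₁ ∧ projAct A '' P₂ = Q₂ ∧ projAct A '' P₃ = Q₃) ∧
    (∀ P₁ P₂ P₃ : Set (ℙ (GaloisField 2 3) (Fin 2 → GaloisField 2 3)),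
      Disjoint P₁ P₂ → Disjoint P₁ P₃ → Disjoint P₂ P₃ →
      P₁.ncard = 5 → P₂.ncard = 3 → P₃.ncard = 1 →
      ∀ A : Matrix.SpecialLinearGroup (Fin 2) (GaloisField 2 3),
        projAct A '' P₁ = P₁ ∧ projAct A '' P₂ = P₂ ∧ projAct A '' P₃ = P₃ →
        A ∈ Subgroup.center (Matrix.SpecialLinearGroup (Fin 2) (GaloisField 2 3))) := by
  classical
  let _ : Fintype (GaloisField 2 3) := Fintype.ofFinite _
  constructor
  · intro P₁ P₂ P₃ Q₁ Q₂ Q₃ hP₁₂ hP₁₃ hP₂₃ hQ₁₂ hQ₁₃ hQ₂₃ hP₁ hP₂ hP₃ hQ₁ hQ₂ hQ₃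
    obtain ⟨A, S, hS, hA₃, hA₂⟩ := exists_normal_form hP₂₃ hP₂ hP₃
    obtain ⟨B, T, hT, hB₃, hB₂⟩ := exists_normal_form hQ₂₃ hQ₂ hQ₃
    obtain ⟨a, b, ha, hab⟩ := exists_affine_image_eq card_F8 hS hT
    obtain ⟨C, hC, hC'⟩ := exists_projAct_eq_affine ha b
    have h₂ : projAct (B * C * A⁻¹) '' P₂ = Q₂ := by
      rw [← hA₂, ← hB₂, ← hab]
      simp [Set.image_image, projAct_mul, projAct_inv_projAct, hC']
    have h₃ : projAct (B * C * A⁻¹) '' P₃ = Q₃ := by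
      rw [← hA₃, ← hB₃]
      simp [projAct_mul, projAct_inv_projAct, hC]
    refine ⟨B * C * A⁻¹, ?_, h₂, h₃⟩
    rw [eq_compl_of_ncard hP₁₂ hP₁₃ hP₂₃ hP₁ hP₂ hP₃,
      eq_compl_of_ncard hQ₁₂ hQ₁₃ hQ₂₃ hQ₁ hQ₂ hQ₃,
      Set.image_compl_eq (projAct_bijective _), Set.image_union, h₂, h₃]
  · rintro P₁ P₂ P₃ - - hP₂₃ - hP₂ hP₃ A ⟨-, hA₂, hA₃⟩
    obtain ⟨B, S, hS, hB₃, hB₂⟩ := exists_normal_form hP₂₃ hP₂ hP₃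
    set C := B⁻¹ * A * B with hCdef
    have hC₃ : projAct C '' {infPt} = {infPt} := by
      apply (projAct_bijective B).1.image_injective
      rw [hB₃, ← hA₃, ← hB₃]
      simp [← projAct_mul, hCdef, mul_assoc]
    have hC₂ : projAct C '' (affPt '' S) = affPt '' S := by
      apply (projAct_bijective B).1.image_injective
      rw [hB₂]
      conv_rhs => rw [← hA₂, ← hB₂]
      simp [Set.image_image, ← projAct_mul, hCdef, mul_assoc]
    have h10 : C.1 1 0 = 0 := (projAct_infPt_eq_iff C).mp (by simpa using hC₃)
    have hdet := C.2
    rw [Matrix.det_fin_two, h10, mul_zero, sub_zero] at hdet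
    have h00 : C.1 0 0 ≠ 0 := left_ne_zero_of_mul_eq_one hdet
    obtain ⟨h1, h0⟩ := affine_eq_id_of_image_eq card_F8 hS (pow_ne_zero 2 h00)
      (d := C.1 0 0 * C.1 0 1) (by
        apply Finset.coe_injective
        apply affPt_injective.image_injective
        conv_rhs => rw [← hC₂]
        simp [Set.image_image, projAct_affPt h10])
    have h00' : C.1 0 0 = 1 := by
      rw [← sub_eq_zero, ← sq_eq_zero_iff]
      linear_combination h1 + (1 - C.1 0 0) * (CharTwo.two_eq_zero : (2 : GaloisField 2 3) = 0)
    have h01 : C.1 0 1 = 0 := (mul_eq_zero.mp h0).resolve_left h00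
    have h11 : C.1 1 1 = 1 := by simpa [h00'] using hdet
    have hC1 : C = 1 := by
      ext i j
      fin_cases i <;> fin_cases j <;> simp [h00', h01, h10, h11]
    have hA1 : A = 1 := by
      have : A = B * C * B⁻¹ := by simp [hCdef, mul_assoc]
      rw [this, hC1, mul_one, mul_inv_cancel]
    rw [hA1]
    exact one_mem _
end

section
/- Let k ≥ 2 and n ≥ k+2, and set λ = (n−k, k−1, 1). If there exists a subgroup H ≤ S_n that is sharply λ-transitive on {1,…,n}, then the (n,k)-star graph S_{n,k} is a Cayley graph. -/
open Equiv

/-- A graph carrying a regular action of a finite group by graph automorphisms is a Cayley graph. -/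
theorem isCayleyGraph_of_regular_action {V : Type*} {Γ : SimpleGraph V} {G : Type} [Group G]
    [Finite G] [MulAction G V] (v₀ : V) (hbij : Function.Bijective fun g : G => g • v₀)
    (hadj : ∀ (g : G) (u v : V), Γ.Adj u v → Γ.Adj (g • u) (g • v)) : IsCayleyGraph Γ := by
  have key (g h : G) : Γ.Adj v₀ ((g⁻¹ * h) • v₀) ↔ Γ.Adj (g • v₀) (h • v₀) := by
    refine ⟨fun H => ?_, fun H => ?_⟩
    · simpa [mul_smul] using hadj g _ _ H
    · simpa [mul_smul] using hadj g⁻¹ _ _ H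
  refine ⟨G, inferInstance, Fintype.ofFinite G, {s | Γ.Adj v₀ (s • v₀)}, by simp, ?_, ⟨?_⟩⟩
  · intro s hs
    simpa using (hadj s⁻¹ _ _ hs).symm
  · refine SimpleGraph.Iso.symm ⟨Equiv.ofBijective _ hbij, ?_⟩
    intro g h
    simp only [Equiv.ofBijective_apply, SimpleGraph.fromRel_adj, Set.mem_ofPred_eq, key]
    refine ⟨fun H => ⟨?_, Or.inl H⟩, fun H => H.2.elim id fun H => H.symm⟩
    rintro rfl
    exact H.ne rfl

instance starVertexMulAction (n k : ℕ) :
    MulAction (Equiv.Perm (Fin n) × Equiv.Perm (Fin k)) (StarVertex n k) where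
  smul g a := phi n k g.1 g.2 a
  one_smul _ := rfl
  mul_smul g h a := by
    refine Subtype.ext (funext fun j => ?_)
    change (g * h).1 (a.1 ((g * h).2⁻¹ j)) = g.1 (h.1 (a.1 (h.2⁻¹ (g.2⁻¹ j))))
    simp [mul_inv_rev]

theorem starVertex_smul_apply {n k : ℕ} (g : Equiv.Perm (Fin n) × Equiv.Perm (Fin k))
    (a : StarVertex n k) (j : Fin k) : (g • a).1 j = g.1 (a.1 (g.2⁻¹ j)) := rfl

theorem val_inv_apply_eq_zero_iff {k : ℕ} {ν : Equiv.Perm (Fin k)} (hν : ν ∈ SkSub k)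
    (j : Fin k) : (ν⁻¹ j).1 = 0 ↔ j.1 = 0 := by
  refine ⟨fun h => ?_, fun h => ?_⟩
  · have := hν _ h
    rw [← Equiv.Perm.mul_apply, mul_inv_cancel, Equiv.Perm.one_apply] at this
    rwa [← this] at h
  · rwa [(SkSub k).inv_mem hν j h]

theorem IsResEdge.smul {n k : ℕ} {g : Equiv.Perm (Fin n) × Equiv.Perm (Fin k)}
    (hg : g.2 ∈ SkSub k) {u v : StarVertex n k} (h : IsResEdge u v) :
    IsResEdge (g • u) (g • v) := by
  refine ⟨fun j hj => ?_, fun j hj => ?_⟩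
  · exact g.1.injective.ne (h.1 _ ((val_inv_apply_eq_zero_iff hg j).2 hj))
  · exact congrArg g.1 (h.2 _ (mt (val_inv_apply_eq_zero_iff hg j).1 hj))

theorem IsStarEdge.smul {n k : ℕ} {g : Equiv.Perm (Fin n) × Equiv.Perm (Fin k)}
    (hg : g.2 ∈ SkSub k) {u v : StarVertex n k} (h : IsStarEdge u v) :
    IsStarEdge (g • u) (g • v) := by
  obtain ⟨i, hi, hswap, hfix⟩ := h
  have hi' : g.2⁻¹ (g.2 i) = i := by simp
  refine ⟨g.2 i, ?_, fun j hj => ?_, fun j hj hji => ?_⟩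
  · rwa [Ne, ← val_inv_apply_eq_zero_iff hg, hi']
  · obtain ⟨h₁, h₂⟩ := hswap _ ((val_inv_apply_eq_zero_iff hg j).2 hj)
    simp only [starVertex_smul_apply, hi']
    exact ⟨congrArg g.1 h₁, congrArg g.1 h₂⟩
  · refine congrArg g.1 (hfix _ (mt (val_inv_apply_eq_zero_iff hg j).1 hj) ?_)
    rintro rfl
    exact hji (by simp)

theorem starGraph_adj_smul {n k : ℕ} {g : Equiv.Perm (Fin n) × Equiv.Perm (Fin k)}
    (hg : g.2 ∈ SkSub k) {u v : StarVertex n k} (h : (starGraph n k).Adj u v) :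
    (starGraph n k).Adj (g • u) (g • v) := by
  simp only [starGraph, SimpleGraph.fromRel_adj] at h ⊢
  exact ⟨(MulAction.injective g).ne h.1,
    h.2.imp (Or.imp (·.smul hg) (·.smul hg)) (Or.imp (·.smul hg) (·.smul hg))⟩

/-- The positions of a vertex other than the first one. -/
def tailPositions (k : ℕ) : Set (Fin k) := {j | j.1 ≠ 0}

theorem ncard_compl_tailPositions {k : ℕ} (hk : 2 ≤ k) : (tailPositions k)ᶜ.ncard = 1 := by
  rw [Set.ncard_eq_one]
  refine ⟨⟨0, by omega⟩, ?_⟩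
  ext j
  simp [tailPositions, Fin.ext_iff]

theorem ncard_tailPositions {k : ℕ} (hk : 2 ≤ k) : (tailPositions k).ncard = k - 1 := by
  have := Set.ncard_add_ncard_compl (tailPositions k)
  rw [ncard_compl_tailPositions hk, Nat.card_eq_fintype_card, Fintype.card_fin] at this
  omega

theorem StarVertex.ncard_compl_range {n k : ℕ} (a : StarVertex n k) :
    (Set.range a.1)ᶜ.ncard = n - k := by
  have := Set.ncard_add_ncard_compl (Set.range a.1)
  rw [Set.ncard_range_of_injective a.2] at this
  simp only [Nat.card_eq_fintype_card, Fintype.card_fin] at this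
  omega

/-- A permutation of positions fixing the first one aligns two vertices whose first entries agree
and whose remaining entries form the same set. -/
theorem exists_mem_SkSub_comp_eq {n k : ℕ} (a b : StarVertex n k)
    (htail : a.1 '' tailPositions k = b.1 '' tailPositions k)
    (hhead : a.1 '' (tailPositions k)ᶜ = b.1 '' (tailPositions k)ᶜ) :
    ∃ ν ∈ SkSub k, ∀ j, a.1 (ν⁻¹ j) = b.1 j := by
  have hex (j : Fin k) : ∃ i, (i ∈ tailPositions k ↔ j ∈ tailPositions k) ∧ a.1 i = b.1 j := by
    by_cases hj : j ∈ tailPositions k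
    · obtain ⟨i, hi, hij⟩ := htail.symm ▸ Set.mem_image_of_mem b.1 hj
      exact ⟨i, by tauto, hij⟩
    · obtain ⟨i, hi, hij⟩ := hhead.symm ▸ Set.mem_image_of_mem b.1 (Set.mem_compl hj)
      exact ⟨i, by rw [Set.mem_compl_iff] at hi; tauto, hij⟩
  choose σ hσ hab using hex
  have hinj : Function.Injective σ := fun x y hxy => b.2 (by rw [← hab, ← hab, hxy])
  let τ : Equiv.Perm (Fin k) := Equiv.ofBijective σ (Finite.injective_iff_bijective.1 hinj)
  refine ⟨τ⁻¹, (SkSub k).inv_mem fun j hj => ?_, fun j => ?_⟩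
  · have h := hσ j
    simp only [tailPositions, Set.mem_ofPred_eq, hj, ne_eq, not_true, iff_false, not_not] at h
    exact Fin.ext (h.trans hj.symm)
  · rw [inv_inv]
    exact hab j

theorem image_comp_inv_tailPositions {k : ℕ} {α : Type*} (f : Fin k → α)
    {ν : Equiv.Perm (Fin k)} (hν : ν ∈ SkSub k) :
    (fun j => f (ν⁻¹ j)) '' tailPositions k = f '' tailPositions k ∧
      (fun j => f (ν⁻¹ j)) '' (tailPositions k)ᶜ = f '' (tailPositions k)ᶜ := by
  have h : ⇑ν⁻¹ '' tailPositions k = tailPositions k := by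
    ext j
    rw [Equiv.image_eq_preimage_symm, Set.mem_preimage]
    have hj := val_inv_apply_eq_zero_iff hν (ν j)
    rw [← Equiv.Perm.mul_apply, inv_mul_cancel, Equiv.Perm.one_apply] at hj
    exact not_congr hj.symm
  refine ⟨?_, ?_⟩
  · rw [← Set.image_image f, h]
  · rw [← Set.image_image f, Set.image_compl_eq ν⁻¹.bijective, h]

/-- Let `k ≥ 2`, `n ≥ k+2` and `λ = (n-k, k-1, 1)`. If there is a subgroup `H ≤ S_n` that
is sharply `λ`-transitive — i.e. `H` acts transitively and freely on ordered triples
`(P₁,P₂,P₃)` of pairwise disjoint subsets of the `n`-point set with `|P₁| = n-k`,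
`|P₂| = k-1`, `|P₃| = 1` — then `S_{n,k}` is a Cayley graph. -/
theorem sharply_lambda_transitive_implies_cayley (n k : ℕ) (hk : 2 ≤ k) (hn : k + 2 ≤ n)
    (H : Subgroup (Equiv.Perm (Fin n)))
    (htrans : ∀ P₁ P₂ P₃ Q₁ Q₂ Q₃ : Set (Fin n),
      Disjoint P₁ P₂ → Disjoint P₁ P₃ → Disjoint P₂ P₃ →
      Disjoint Q₁ Q₂ → Disjoint Q₁ Q₃ → Disjoint Q₂ Q₃ →
      P₁.ncard = n - k → P₂.ncard = k - 1 → P₃.ncard = 1 →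
      Q₁.ncard = n - k → Q₂.ncard = k - 1 → Q₃.ncard = 1 →
      ∃ μ ∈ H, ⇑μ '' P₁ = Q₁ ∧ ⇑μ '' P₂ = Q₂ ∧ ⇑μ '' P₃ = Q₃)
    (hfree : ∀ P₁ P₂ P₃ : Set (Fin n),
      Disjoint P₁ P₂ → Disjoint P₁ P₃ → Disjoint P₂ P₃ →
      P₁.ncard = n - k → P₂.ncard = k - 1 → P₃.ncard = 1 →
      ∀ μ ∈ H, ⇑μ '' P₁ = P₁ ∧ ⇑μ '' P₂ = P₂ ∧ ⇑μ '' P₃ = P₃ → μ = 1) :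
    IsCayleyGraph (starGraph n k) := by
  have hd₁ (a : StarVertex n k) (s : Set (Fin k)) : Disjoint (Set.range a.1)ᶜ (a.1 '' s) :=
    (Set.disjoint_compl_left_iff_subset).2 (Set.image_subset_range _ _)
  have hd₂ (a : StarVertex n k) : Disjoint (a.1 '' tailPositions k) (a.1 '' (tailPositions k)ᶜ) :=
    (Set.disjoint_image_iff a.2).2 disjoint_compl_right
  have hc₂ (a : StarVertex n k) : (a.1 '' tailPositions k).ncard = k - 1 := by
    rw [Set.ncard_image_of_injective _ a.2, ncard_tailPositions hk]
  have hc₃ (a : StarVertex n k) : (a.1 '' (tailPositions k)ᶜ).ncard = 1 := by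
    rw [Set.ncard_image_of_injective _ a.2, ncard_compl_tailPositions hk]
  let e := eVert n k (by omega)
  refine isCayleyGraph_of_regular_action (G := H.prod (SkSub k)) e ⟨?_, ?_⟩
    fun g u v h => starGraph_adj_smul (Subgroup.mem_prod.1 g.2).2 h
  · have stab (g : H.prod (SkSub k)) (hg : g • e = e) : g = 1 := by
      obtain ⟨⟨μ, ν⟩, hμν⟩ := g
      obtain ⟨hμ, hν⟩ := Subgroup.mem_prod.1 hμν
      have hfix (j : Fin k) : μ (e.1 (ν⁻¹ j)) = e.1 j := congrFun (congrArg Subtype.val hg) j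
      have himg := image_comp_inv_tailPositions (fun j => μ (e.1 j)) hν
      simp only [hfix] at himg
      have hrange : μ '' Set.range e.1 = Set.range e.1 := by
        rw [← Set.image_univ, ← Set.union_compl_self (tailPositions k), Set.image_union,
          Set.image_union, Set.image_image, Set.image_image, himg.1, himg.2]
      have h1 : μ = 1 := hfree _ _ _ (hd₁ e _) (hd₁ e _) (hd₂ e) e.ncard_compl_range (hc₂ e)
        (hc₃ e) μ hμ ⟨by rw [Set.image_compl_eq μ.bijective, hrange],
          by rw [Set.image_image, himg.1], by rw [Set.image_image, himg.2]⟩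
      subst h1
      have h2 : ν = 1 := inv_eq_one.1 (Equiv.ext fun j => e.2 (hfix j))
      subst h2
      rfl
    intro g h hgh
    have : (h⁻¹ * g) • e = e := by
      rw [mul_smul, inv_smul_eq_iff]
      exact hgh
    exact (inv_mul_eq_one.1 (stab _ this)).symm
  · intro b
    obtain ⟨μ, hμ, -, h₂, h₃⟩ := htrans _ _ _ _ _ _ (hd₁ e _) (hd₁ e _) (hd₂ e) (hd₁ b _)
      (hd₁ b _) (hd₂ b) e.ncard_compl_range (hc₂ e) (hc₃ e) b.ncard_compl_range (hc₂ b) (hc₃ b)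
    rw [Set.image_image] at h₂ h₃
    obtain ⟨ν, hν, h⟩ := exists_mem_SkSub_comp_eq (phi n k μ 1 e) b h₂ h₃
    exact ⟨⟨(μ, ν), Subgroup.mem_prod.2 ⟨hμ, hν⟩⟩, Subtype.ext (funext h)⟩
end

section
/- Let d ≥ 8 be an integer, and set k = 2^d − 3, r = (d² − d)/2 − 2, and t = (2^d)! / (3! · ∏_{i=0}^{d−1}(2^d − 2^i)), a positive rational number. Then (k−1)!/t < C(k−1, r), where C(k−1, r) denotes the binomial coefficient (k−1 choose r). -/
open Equiv

theorem four_mul_sq_le_two_pow {d : ℕ} (hd : 8 ≤ d) : 4 * d ^ 2 ≤ 2 ^ d := by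
  induction d, hd using Nat.le_induction with
  | base => norm_num
  | succ n hn ih =>
    rw [pow_succ 2 n]
    nlinarith

theorem four_pow_le_choose {n r : ℕ} (h : 5 * r ≤ n + 1) : 4 ^ r ≤ n.choose r := by
  have h1 : (n + 1 - r) ^ r ≤ n.descFactorial r := Nat.pow_sub_le_descFactorial n r
  rw [Nat.descFactorial_eq_factorial_mul_choose] at h1
  have h2 : (4 * r) ^ r ≤ (n + 1 - r) ^ r := Nat.pow_le_pow_left (by omega) r
  have h3 : r.factorial * n.choose r ≤ r ^ r * n.choose r :=
    Nat.mul_le_mul_right _ (Nat.factorial_le_pow r)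
  rw [mul_pow, mul_comm] at h2
  exact Nat.le_of_mul_le_mul_left ((h2.trans h1).trans h3) Nat.pow_self_pos

theorem prod_two_pow_sub_le (d : ℕ) :
    (∏ i ∈ Finset.range d, ((2 : ℚ) ^ d - 2 ^ i)) ≤ (2 ^ d) ^ d := by
  calc _ ≤ ∏ _i ∈ Finset.range d, (2 : ℚ) ^ d := by
        refine Finset.prod_le_prod (fun i hi => ?_) (fun i _ => ?_)
        · exact sub_nonneg.2 (pow_le_pow_right₀ one_le_two (Finset.mem_range.1 hi).le)
        · exact sub_le_self _ (by positivity)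
    _ = _ := by simp

/-- Let `d ≥ 8`, `k = 2^d - 3`, `r = (d² - d)/2 - 2`, and
`t = (2^d)! / (3! · ∏_{i=0}^{d-1} (2^d - 2^i))` (a positive rational). Then
`(k-1)!/t < C(k-1, r)`. -/
theorem agl_binomial_bound (d : ℕ) (hd : 8 ≤ d) :
    (Nat.factorial (2 ^ d - 3 - 1) : ℚ) /
        ((Nat.factorial (2 ^ d) : ℚ) /
          ((Nat.factorial 3 : ℚ) *
            Finset.prod (Finset.range d) fun i => ((2 : ℚ) ^ d - 2 ^ i))) <
      (Nat.choose (2 ^ d - 3 - 1) ((d ^ 2 - d) / 2 - 2) : ℚ) := by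
  have hN := four_mul_sq_le_two_pow hd
  have hP := prod_two_pow_sub_le d
  obtain ⟨r, hr⟩ : ∃ r, d ^ 2 = d + 2 * r + 4 := by
    obtain ⟨c, hc⟩ := (Nat.even_mul_pred_self d).two_dvd
    obtain ⟨e, rfl⟩ : ∃ e, d = e + 8 := ⟨d - 8, by omega⟩
    rw [show e + 8 - 1 = e + 7 by omega] at hc
    exact ⟨c - 2, by zify [show 2 ≤ c by nlinarith]; zify at hc; linarith⟩
  obtain ⟨m, hm⟩ : ∃ m, 2 ^ d = m + 4 := ⟨2 ^ d - 4, by omega⟩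
  have hmQ : (2 : ℚ) ^ d = m + 4 := by exact_mod_cast hm
  have hm252 : 252 ≤ m := by nlinarith
  have hchoose : (4 : ℚ) ^ r ≤ m.choose r := by
    exact_mod_cast four_pow_le_choose (show 5 * r ≤ m + 1 by nlinarith)
  have hfact : ((m + 4).factorial : ℚ) =
      (m + 4) * (m + 3) * (m + 2) * (m + 1) * m.factorial := by
    simp only [Nat.factorial_succ]
    push_cast
    ring
  have hpow : ((2 : ℚ) ^ d) ^ d = 16 * (m + 4) * 4 ^ r := by
    rw [← hmQ, ← pow_mul, ← sq, hr, show (4 : ℚ) = 2 ^ 2 by norm_num, ← pow_mul, pow_add, pow_add]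
    ring
  rw [hm, show (d ^ 2 - d) / 2 - 2 = r by omega, show m + 4 - 3 - 1 = m by omega]
  have hf : (0 : ℚ) < m.factorial := by exact_mod_cast m.factorial_pos
  generalize (∏ i ∈ Finset.range d, ((2 : ℚ) ^ d - 2 ^ i)) = P at hP ⊢
  rw [hpow] at hP
  have hmle : (252 : ℚ) ≤ m := by exact_mod_cast hm252
  have hlhs : (m.factorial : ℚ) / ((m + 4).factorial / ((Nat.factorial 3 : ℚ) * P)) =
      6 * P / ((m + 4) * (m + 3) * (m + 2) * (m + 1)) := by
    rw [hfact, show ((Nat.factorial 3 : ℕ) : ℚ) = 6 by norm_num [Nat.factorial], div_div_eq_mul_div]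
    field_simp
  rw [hlhs]
  refine lt_of_lt_of_le ?_ hchoose
  rw [div_lt_iff₀ (by positivity)]
  have hcube : (96 : ℚ) < (m + 3) * (m + 2) * (m + 1) := by
    nlinarith [mul_nonneg (show (0 : ℚ) ≤ m by linarith) (show (0 : ℚ) ≤ m by linarith),
      pow_nonneg (show (0 : ℚ) ≤ m by linarith) 3]
  calc 6 * P ≤ (m + 4) * 4 ^ r * 96 := by linarith
    _ < (m + 4) * 4 ^ r * ((m + 3) * (m + 2) * (m + 1)) :=
        mul_lt_mul_of_pos_left hcube (by positivity)
    _ = _ := by ring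
end
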